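/- arXiv:1208.6349 — 10 statements merged into one kernel-verified Lean document; each statement's English description precedes it below -/
import Mathlib

section
/- Let $(\beta_j)_{j\in\mathbb{N}}$ be nonnegative real numbers, and let $(\mathbb{A}_v)$ and $(\mathbb{B}_v)$ be families of nonnegative real numbers indexed by the finite subsets $v$ of $\mathbb{N}$, satisfying $\mathbb{A}_v \le \sum_{k\in v} \beta_k\, \mathbb{A}_{v\setminus\{k\}} + \mathbb{B}_v$ for every finite subset $v \subset \mathbb{N}$ (including $v = \emptyset$). Then for every finite subset $v \subset \mathbb{N}$ one has $\mathbb{A}_v \le \sum_{w \subseteq v} |w|!\, \big(\prod_{j\in w} \beta_j\big)\, \mathbb{B}_{v\setminus w}$, where the sum is over all subsets $w$ of $v$, $|w|$ denotes the cardinality of $w$, and an empty product equals $1$. -/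
/-- Pairs `(k, w)` with `k ∈ v` and `w ⊆ v \ {k}` correspond to pairs `(u, k)` with `u ⊆ v` and
`k ∈ u`, through `u = insert k w`. -/
theorem Finset.sum_sum_powerset_erase {α M : Type*} [DecidableEq α] [AddCommMonoid M]
    (v : Finset α) (f : α → Finset α → M) :
    ∑ k ∈ v, ∑ w ∈ (v.erase k).powerset, f k w =
      ∑ u ∈ v.powerset, ∑ k ∈ u, f k (u.erase k) := by
  rw [Finset.sum_sigma', Finset.sum_sigma']
  refine Finset.sum_bij' (fun p _ => ⟨insert p.1 p.2, p.1⟩) (fun q _ => ⟨q.2, q.1.erase q.2⟩)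
    ?_ ?_ ?_ ?_ ?_
  · rintro ⟨k, w⟩ h
    simp only [Finset.mem_sigma, Finset.mem_powerset, Finset.subset_erase] at h ⊢
    exact ⟨Finset.insert_subset h.1 h.2.1, Finset.mem_insert_self k w⟩
  · rintro ⟨u, k⟩ h
    simp only [Finset.mem_sigma, Finset.mem_powerset] at h ⊢
    exact ⟨h.1 h.2, Finset.erase_subset_erase k h.1⟩
  · rintro ⟨k, w⟩ h
    simp only [Finset.mem_sigma, Finset.mem_powerset, Finset.subset_erase] at h
    simp [Finset.erase_insert h.2.2]
  · rintro ⟨u, k⟩ h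
    simp only [Finset.mem_sigma, Finset.mem_powerset] at h
    simp [Finset.insert_erase h.2]
  · rintro ⟨k, w⟩ h
    simp only [Finset.mem_sigma, Finset.mem_powerset, Finset.subset_erase] at h
    simp [Finset.erase_insert h.2.2]

/-- The sum `∑ w ⊆ v, |w|! * (∏ j ∈ w, β j) * B (v \ w)` solves the recursion with equality. -/
theorem sum_powerset_factorial_mul_prod_eq {α R : Type*} [DecidableEq α] [CommSemiring R]
    (β : α → R) (B : Finset α → R) (v : Finset α) :
    ∑ w ∈ v.powerset, (w.card.factorial : R) * (∏ j ∈ w, β j) * B (v \ w) =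
      (∑ k ∈ v, β k * ∑ w ∈ (v.erase k).powerset,
        (w.card.factorial : R) * (∏ j ∈ w, β j) * B (v.erase k \ w)) + B v := by
  simp_rw [Finset.mul_sum]
  rw [Finset.sum_sum_powerset_erase v fun k w =>
    β k * ((w.card.factorial : R) * (∏ j ∈ w, β j) * B (v.erase k \ w))]
  have hsingle : B v = ∑ u ∈ v.powerset, if u = ∅ then B v else 0 := by simp
  conv_rhs => rw [hsingle]
  rw [← Finset.sum_add_distrib]
  refine Finset.sum_congr rfl fun u _ => ?_
  rcases u.eq_empty_or_nonempty with rfl | hne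
  · simp
  have hterm : ∀ k ∈ u, β k * (((u.erase k).card.factorial : R) * (∏ j ∈ u.erase k, β j) *
      B (v.erase k \ u.erase k)) =
        ((u.card - 1).factorial : R) * (∏ j ∈ u, β j) * B (v \ u) := by
    intro k hk
    have hsdiff : v.erase k \ u.erase k = v \ u := by
      ext x
      simp only [Finset.mem_sdiff, Finset.mem_erase]
      grind
    rw [hsdiff, Finset.card_erase_of_mem hk, ← Finset.mul_prod_erase u β hk]
    ring
  rw [Finset.sum_congr rfl hterm, Finset.sum_const, nsmul_eq_mul, if_neg hne.ne_empty, add_zero,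
    ← Nat.mul_factorial_pred hne.card_ne_zero, Nat.cast_mul]
  ring

/-- Recursion lemma (Lemma 6 in the paper): if nonnegative numbers `A v`, `B v`
indexed by finite subsets `v ⊂ ℕ` satisfy
`A v ≤ ∑ k ∈ v, β k * A (v \ {k}) + B v` for every finite `v`, then
`A v ≤ ∑ w ⊆ v, |w|! * (∏ j ∈ w, β j) * B (v \ w)`. -/
theorem stmt0 (β : ℕ → ℝ) (hβ : ∀ k, 0 ≤ β k)
    (A B : Finset ℕ → ℝ) (hA : ∀ v, 0 ≤ A v) (hB : ∀ v, 0 ≤ B v)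
    (hrec : ∀ v : Finset ℕ, A v ≤ (∑ k ∈ v, β k * A (v.erase k)) + B v) :
    ∀ v : Finset ℕ,
      A v ≤ ∑ w ∈ v.powerset, (w.card.factorial : ℝ) * (∏ j ∈ w, β j) * B (v \ w) := by
  intro v
  induction v using Finset.strongInduction with
  | H v ih =>
    rw [sum_powerset_factorial_mul_prod_eq]
    refine (hrec v).trans (add_le_add_left (Finset.sum_le_sum fun k hk => ?_) _)
    exact mul_le_mul_of_nonneg_left (ih _ (Finset.erase_ssubset hk)) (hβ k)
end

section
/- For every finite set $u$, $6 \cdot \sum_{v \subseteq u} (|v|+1)! \cdot (|u\setminus v|+1)! = (|u|+3)!$, where the sum is over all subsets $v$ of $u$ and $|v|$ denotes the cardinality of $v$; equivalently $\sum_{v \subseteq u} (|v|+1)!\,(|u\setminus v|+1)! = (|u|+3)!/6$. -/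
theorem six_mul_sum_range_succ_mul (n k : ℕ) (hk : k ≤ n + 1) :
    6 * ∑ m ∈ Finset.range k, (m + 1) * (n - m + 1) + k * (k + 1) * (2 * k + 1)
      = 3 * (n + 2) * (k * (k + 1)) := by
  induction k with
  | zero => simp
  | succ k ih =>
    obtain ⟨d, rfl⟩ := Nat.exists_eq_add_of_le (show k ≤ n by omega)
    have h := ih (by omega)
    rw [Finset.sum_range_succ, Nat.add_sub_cancel_left]
    linarith

/-- For every finite set `u`, `6 * ∑_{v ⊆ u} (|v|+1)! * (|u \ v|+1)! = (|u| + 3)!`. -/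
theorem stmt2 {α : Type*} [DecidableEq α] (u : Finset α) :
    6 * ∑ v ∈ u.powerset, (v.card + 1).factorial * ((u \ v).card + 1).factorial
      = (u.card + 3).factorial := by
  have h₁ : ∑ v ∈ u.powerset, (v.card + 1).factorial * ((u \ v).card + 1).factorial
      = ∑ v ∈ u.powerset, (v.card + 1).factorial * (u.card - v.card + 1).factorial :=
    Finset.sum_congr rfl fun v hv ↦ by
      rw [Finset.card_sdiff_of_subset (Finset.mem_powerset.mp hv)]
  have h₂ : ∀ m ∈ Finset.range (u.card + 1),
      u.card.choose m • ((m + 1).factorial * (u.card - m + 1).factorial)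
        = u.card.factorial * ((m + 1) * (u.card - m + 1)) := fun m hm ↦ by
    have hm' : m ≤ u.card := by grind
    rw [← Nat.choose_mul_factorial_mul_factorial hm', smul_eq_mul, Nat.factorial_succ,
      Nat.factorial_succ]
    ring
  rw [h₁, Finset.sum_powerset_apply_card
      (fun m ↦ (m + 1).factorial * (u.card - m + 1).factorial),
    Finset.sum_congr rfl h₂, ← Finset.mul_sum, Nat.factorial_succ, Nat.factorial_succ,
    Nat.factorial_succ]
  have h := six_mul_sum_range_succ_mul u.card (u.card + 1) le_rfl
  have h₃ : 6 * ∑ m ∈ Finset.range (u.card + 1), (m + 1) * (u.card - m + 1)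
      = (u.card + 3) * (u.card + 2) * (u.card + 1) := by linarith
  rw [mul_left_comm, h₃]
  ring
end

section
/- (Stechkin-type tail bound.) Let $(b_j)_{j \ge 1}$ be a non-increasing sequence of nonnegative real numbers and let $p \in (0,1)$ be such that $\sum_{j\ge 1} b_j^p < \infty$. Then for every integer $s \ge 1$, $\sum_{j \ge s+1} b_j \le \min\!\big(\tfrac{1}{1/p - 1},\, 1\big)\, \big(\sum_{j\ge 1} b_j^p\big)^{1/p}\, s^{-(1/p - 1)}$ (in particular the tail series converges). -/
/-- A tangent-line bound for `x ↦ x ^ (-r)`, comparing a value with a telescoping difference. -/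
theorem mul_rpow_neg_add_one_le_sub {r x : ℝ} (hr : 0 ≤ r) (hx : 0 < x) :
    r * (x + 1) ^ (-(r + 1)) ≤ x ^ (-r) - (x + 1) ^ (-r) := by
  have hy : 0 < x + 1 := by linarith
  have hq : 0 < x / (x + 1) := div_pos hx hy
  have hlog : Real.log (x / (x + 1)) ≤ -(1 / (x + 1)) := by
    refine (Real.log_le_sub_one_of_pos hq).trans_eq ?_
    field_simp
    ring
  have hbern : 1 + r * (1 / (x + 1)) ≤ (x / (x + 1)) ^ (-r) := by
    rw [Real.rpow_def_of_pos hq]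
    have hexp := Real.add_one_le_exp (Real.log (x / (x + 1)) * -r)
    nlinarith [mul_le_mul_of_nonneg_left hlog hr]
  rw [Real.div_rpow hx.le hy.le, le_div_iff₀ (Real.rpow_pos_of_pos hy _)] at hbern
  have hsplit : (x + 1) ^ (-(r + 1)) = (1 / (x + 1)) * (x + 1) ^ (-r) := by
    rw [neg_add, Real.rpow_add hy, Real.rpow_neg_one]
    ring
  rw [hsplit]
  linarith

theorem sum_range_rpow_neg_add_one_le {r : ℝ} (hr : 0 < r) {s : ℕ} (hs : 1 ≤ s) (n : ℕ) :
    ∑ i ∈ Finset.range n, ((s + 1 + i : ℕ) : ℝ) ^ (-(r + 1)) ≤ 1 / r * (s : ℝ) ^ (-r) := by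
  have htel : ∑ i ∈ Finset.range n, r * ((s + 1 + i : ℕ) : ℝ) ^ (-(r + 1)) ≤
      ∑ i ∈ Finset.range n, (((s + i : ℕ) : ℝ) ^ (-r) - ((s + (i + 1) : ℕ) : ℝ) ^ (-r)) := by
    refine Finset.sum_le_sum fun i _ => ?_
    have hx : (0 : ℝ) < (s + i : ℕ) := by exact_mod_cast (by omega : 0 < s + i)
    have h := mul_rpow_neg_add_one_le_sub hr.le hx
    have e₁ : ((s + 1 + i : ℕ) : ℝ) = (s + i : ℕ) + 1 := by push_cast; ring
    have e₂ : ((s + (i + 1) : ℕ) : ℝ) = (s + i : ℕ) + 1 := by push_cast; ring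
    rwa [e₁, e₂]
  rw [Finset.sum_range_sub' (fun i => ((s + i : ℕ) : ℝ) ^ (-r)), ← Finset.mul_sum] at htel
  have hpos : 0 ≤ ((s + n : ℕ) : ℝ) ^ (-r) := Real.rpow_nonneg (Nat.cast_nonneg _) _
  rw [one_div_mul_eq_div, le_div_iff₀' hr]
  simp only [add_zero] at htel
  linarith

/-- Weak-type decay of a non-increasing sequence with summable `p`-th powers. -/
theorem rpow_le_tsum_div {b : ℕ → ℝ} {p : ℝ} (hp0 : 0 < p)
    (hbnonneg : ∀ j, 1 ≤ j → 0 ≤ b j)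
    (hbmono : ∀ j k, 1 ≤ j → j ≤ k → b k ≤ b j)
    (hsum : Summable (fun j : ℕ => b (j + 1) ^ p)) {k : ℕ} (hk : 1 ≤ k) :
    b k ^ p ≤ (∑' j : ℕ, b (j + 1) ^ p) / k := by
  have hk0 : (0 : ℝ) < k := by exact_mod_cast hk
  rw [le_div_iff₀' hk0]
  calc (k : ℝ) * b k ^ p = ∑ _i ∈ Finset.range k, b k ^ p := by simp
    _ ≤ ∑ i ∈ Finset.range k, b (i + 1) ^ p := by
        refine Finset.sum_le_sum fun i hi => ?_
        have := Finset.mem_range.mp hi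
        exact Real.rpow_le_rpow (hbnonneg k hk) (hbmono _ _ (by omega) (by omega)) hp0.le
    _ ≤ ∑' j : ℕ, b (j + 1) ^ p :=
        hsum.sum_le_tsum _ fun j _ => Real.rpow_nonneg (hbnonneg _ (by omega)) _

/-- Stechkin-type tail bound: if `(b_j)_{j ≥ 1}` is a non-increasing sequence of
nonnegative reals with `∑_{j≥1} b_j^p < ∞` for some `p ∈ (0,1)`, then for every
integer `s ≥ 1` the tail series converges and
`∑_{j ≥ s+1} b_j ≤ min (1/(1/p - 1)) 1 * (∑_{j≥1} b_j^p)^{1/p} * s^{-(1/p - 1)}`.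
(The sequence is indexed by `j ≥ 1`; `b (j+1)` for `j : ℕ` runs through `b_1, b_2, …`,
and `b (s+1+j)` for `j : ℕ` runs through the tail `b_{s+1}, b_{s+2}, …`.) -/
theorem stmt3 (b : ℕ → ℝ) (p : ℝ) (hp0 : 0 < p) (hp1 : p < 1)
    (hbnonneg : ∀ j, 1 ≤ j → 0 ≤ b j)
    (hbmono : ∀ j k, 1 ≤ j → j ≤ k → b k ≤ b j)
    (hsum : Summable (fun j : ℕ => b (j + 1) ^ p)) :
    ∀ s : ℕ, 1 ≤ s →
      Summable (fun j : ℕ => b (s + 1 + j)) ∧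
      (∑' j : ℕ, b (s + 1 + j)) ≤
        min (1 / (1 / p - 1)) 1 * (∑' j : ℕ, b (j + 1) ^ p) ^ (1 / p) *
          (s : ℝ) ^ (-(1 / p - 1)) := by
  intro s hs
  set S := ∑' j : ℕ, b (j + 1) ^ p with hS
  have hs0 : (0 : ℝ) < s := by exact_mod_cast hs
  have hr : 0 < 1 / p - 1 := by
    rw [sub_pos, lt_div_iff₀ hp0]
    linarith
  have hS0 : 0 ≤ S := tsum_nonneg fun j => Real.rpow_nonneg (hbnonneg _ (by omega)) _
  have htail (j : ℕ) : 0 ≤ b (s + 1 + j) := hbnonneg _ (by omega)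
  have hdecay (k : ℕ) (hk : 1 ≤ k) : b k ^ p ≤ S / k :=
    rpow_le_tsum_div hp0 hbnonneg hbmono hsum hk
  have hintegral (n : ℕ) : ∑ i ∈ Finset.range n, b (s + 1 + i) ≤
      1 / (1 / p - 1) * (S ^ (1 / p) * (s : ℝ) ^ (-(1 / p - 1))) := by
    calc ∑ i ∈ Finset.range n, b (s + 1 + i)
        ≤ ∑ i ∈ Finset.range n,
            S ^ (1 / p) * ((s + 1 + i : ℕ) : ℝ) ^ (-((1 / p - 1) + 1)) := by
          refine Finset.sum_le_sum fun i _ => ?_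
          have h := Real.rpow_le_rpow (Real.rpow_nonneg (htail i) p)
            (hdecay (s + 1 + i) (by omega)) (one_div_pos.mpr hp0).le
          rw [sub_add_cancel]
          rwa [← Real.rpow_mul (htail i), mul_one_div_cancel hp0.ne', Real.rpow_one,
            Real.div_rpow hS0 (Nat.cast_nonneg _), div_eq_mul_inv,
            ← Real.rpow_neg (Nat.cast_nonneg _)] at h
      _ ≤ S ^ (1 / p) * (1 / (1 / p - 1) * (s : ℝ) ^ (-(1 / p - 1))) := by
          rw [← Finset.mul_sum]
          exact mul_le_mul_of_nonneg_left (sum_range_rpow_neg_add_one_le hr hs n)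
            (Real.rpow_nonneg hS0 _)
      _ = _ := by ring
  have hinterp (n : ℕ) : ∑ i ∈ Finset.range n, b (s + 1 + i) ≤
      S ^ (1 / p) * (s : ℝ) ^ (-(1 / p - 1)) := by
    have hbs : 0 ≤ b s := hbnonneg s hs
    have hhead : b s ^ (1 - p) ≤ (S / s) ^ (1 / p - 1) := by
      have h := Real.rpow_le_rpow (Real.rpow_nonneg hbs p) (hdecay s hs) hr.le
      rwa [← Real.rpow_mul hbs, mul_sub, mul_one_div_cancel hp0.ne', mul_one] at h
    have hpow : ∑ i ∈ Finset.range n, b (s + 1 + i) ^ p ≤ S := by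
      have hsum' : Summable fun i : ℕ => b (i + s + 1) ^ p := (summable_nat_add_iff s).mpr hsum
      calc ∑ i ∈ Finset.range n, b (s + 1 + i) ^ p
          = ∑ i ∈ Finset.range n, b (i + s + 1) ^ p :=
            Finset.sum_congr rfl fun i _ => by rw [show s + 1 + i = i + s + 1 by omega]
        _ ≤ ∑' i : ℕ, b (i + s + 1) ^ p :=
            hsum'.sum_le_tsum _ fun j _ => Real.rpow_nonneg (hbnonneg _ (by omega)) _
        _ ≤ S := by
            rw [hS, ← hsum.sum_add_tsum_nat_add s]
            exact le_add_of_nonneg_left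
              (Finset.sum_nonneg fun j _ => Real.rpow_nonneg (hbnonneg _ (by omega)) _)
    calc ∑ i ∈ Finset.range n, b (s + 1 + i)
        ≤ ∑ i ∈ Finset.range n, (S / s) ^ (1 / p - 1) * b (s + 1 + i) ^ p := by
          refine Finset.sum_le_sum fun i _ => ?_
          have hfac : b (s + 1 + i) = b (s + 1 + i) ^ (1 - p) * b (s + 1 + i) ^ p := by
            rw [← Real.rpow_add' (htail i) (by simp), sub_add_cancel, Real.rpow_one]
          calc b (s + 1 + i) = b (s + 1 + i) ^ (1 - p) * b (s + 1 + i) ^ p := hfac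
            _ ≤ _ := mul_le_mul_of_nonneg_right
                ((Real.rpow_le_rpow (htail i) (hbmono _ _ hs (by omega)) (by linarith)).trans
                  hhead) (Real.rpow_nonneg (htail i) p)
      _ ≤ (S / s) ^ (1 / p - 1) * S := by
          rw [← Finset.mul_sum]
          exact mul_le_mul_of_nonneg_left hpow
            (Real.rpow_nonneg (div_nonneg hS0 hs0.le) _)
      _ = S ^ (1 / p) * (s : ℝ) ^ (-(1 / p - 1)) := by
          have hSpow : S ^ (1 / p) = S ^ (1 / p - 1) * S := by
            conv_rhs => rw [← Real.rpow_one S, ← Real.rpow_mul hS0, one_mul]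
            rw [← Real.rpow_add' hS0 (by simp [hp0.ne']), sub_add_cancel]
          rw [hSpow, Real.div_rpow hS0 hs0.le, Real.rpow_neg hs0.le]
          ring
  refine ⟨summable_of_sum_range_le htail hinterp, ?_⟩
  rw [mul_assoc, min_mul_of_nonneg _ _
    (mul_nonneg (Real.rpow_nonneg hS0 _) (Real.rpow_nonneg hs0.le _)), one_mul]
  exact Real.tsum_le_of_sum_range_le htail fun n => le_min (hintegral n) (hinterp n)
end

section
/- (Parametric regularity, abstract form of the $V$-norm estimate.) Let $V$ be a real Hilbert space, $f$ a continuous linear functional on $V$, and let $B_0, \Psi_1, \dots, \Psi_s$ be continuous bilinear forms on $V$. Let $a_{\min} > 0$ and suppose that for every $y = (y_1,\dots,y_s)$ in the closed cube $[-1/2,1/2]^s$, the bilinear form $B(y) := B_0 + \sum_{j=1}^s y_j \Psi_j$ satisfies the coercivity bound $B(y)(v,v) \ge a_{\min}\,\|v\|_V^2$ for all $v \in V$. Then: (i) for every $y \in [-1/2,1/2]^s$ there is a unique $u(y) \in V$ with $B(y)(u(y), v) = f(v)$ for all $v \in V$, and $\|u(y)\|_V \le \|f\|_{V^*}/a_{\min}$;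 (ii) the solution map $y \mapsto u(y)$ is infinitely differentiable on the open cube $(-1/2,1/2)^s$; (iii) for every multi-index $\nu \in \mathbb{N}_0^s$ and every $y \in (-1/2,1/2)^s$, the mixed partial derivative satisfies $\|\partial^{\nu}_y u(y)\|_V \le |\nu|!\, \big(\prod_{j=1}^s b_j^{\nu_j}\big)\, \|f\|_{V^*}/a_{\min}$, where $b_j := \|\Psi_j\|/a_{\min}$ with $\|\Psi_j\|$ the operator norm of the bilinear form $\Psi_j$, and $|\nu| = \nu_1 + \cdots + \nu_s$. -/
open InnerProductSpace

section Affine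

variable {E ι : Type*} [NormedAddCommGroup E] [NormedSpace ℝ E] [Fintype ι]

theorem contDiff_const_add_sum_smul (c : E) (e : ι → E) {n : WithTop ℕ∞} :
    ContDiff ℝ n fun y : ι → ℝ => c + ∑ j, y j • e j := by
  fun_prop

theorem fderiv_const_add_sum_smul_single [DecidableEq ι] (c : E) (e : ι → E) (y : ι → ℝ) (j : ι) :
    fderiv ℝ (fun y : ι → ℝ => c + ∑ j, y j • e j) y (Pi.single j 1) = e j := by
  have h : HasFDerivAt (fun y : ι → ℝ => c + ∑ j, y j • e j)
      (∑ i, (ContinuousLinearMap.proj (R := ℝ) (φ := fun _ : ι => ℝ) i).smulRight (e i)) y :=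
    (HasFDerivAt.fun_sum fun i _ =>
      (hasFDerivAt_apply (𝕜 := ℝ) i y).smul_const (e i)).const_add c
  rw [h.fderiv]
  simp [Pi.single_apply]

end Affine

section Coercive

variable {V : Type*} [NormedAddCommGroup V] [InnerProductSpace ℝ V]

/-- The a priori estimate for a variational problem with a coercive form. -/
theorem norm_le_of_coercive {A : V →L[ℝ] V →L[ℝ] ℝ} {a : ℝ} (ha : 0 < a)
    (hA : ∀ v, a * ‖v‖ ^ 2 ≤ A v v) (v : V) : ‖v‖ ≤ ‖A v‖ / a := by
  rw [le_div_iff₀ ha]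
  rcases (norm_nonneg v).eq_or_lt with h | h
  · rw [← h]
    simp
  · have h1 : A v v ≤ ‖A v‖ * ‖v‖ := (le_abs_self _).trans ((A v).le_opNorm v)
    have h2 := hA v
    refine le_of_mul_le_mul_right ?_ h
    nlinarith

variable [CompleteSpace V]

/-- A coercive form, seen as a map into the dual space, is a continuous linear equivalence. -/
theorem exists_continuousLinearEquiv_of_coercive {A : V →L[ℝ] V →L[ℝ] ℝ} {a : ℝ} (ha : 0 < a)
    (hA : ∀ v, a * ‖v‖ ^ 2 ≤ A v v) :
    ∃ e : V ≃L[ℝ] (V →L[ℝ] ℝ), (e : V →L[ℝ] V →L[ℝ] ℝ) = A := by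
  have hc : IsCoercive A := ⟨a, ha, fun v => by simpa [pow_two, mul_assoc] using hA v⟩
  have hinj : A.ker = ⊥ := by
    refine LinearMap.ker_eq_bot'.2 fun v hv => ?_
    have h : A v = 0 := hv
    simpa [h] using norm_le_of_coercive ha hA v
  have hsurj : A.range = ⊤ := by
    refine LinearMap.range_eq_top.2 fun g => ?_
    refine ⟨hc.continuousLinearEquivOfBilin.symm ((toDual ℝ V).symm g), ?_⟩
    ext w
    have h := hc.continuousLinearEquivOfBilin_apply
      (hc.continuousLinearEquivOfBilin.symm ((toDual ℝ V).symm g)) w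
    simpa using h.symm
  exact ⟨ContinuousLinearEquiv.ofBijective A hinj hsurj, by ext; rfl⟩

theorem apply_inverse_of_coercive {A : V →L[ℝ] V →L[ℝ] ℝ} {a : ℝ} (ha : 0 < a)
    (hA : ∀ v, a * ‖v‖ ^ 2 ≤ A v v) (g : V →L[ℝ] ℝ) : A (A.inverse g) = g := by
  obtain ⟨e, rfl⟩ := exists_continuousLinearEquiv_of_coercive ha hA
  simp

theorem inverse_apply_of_coercive {A : V →L[ℝ] V →L[ℝ] ℝ} {a : ℝ} (ha : 0 < a)
    (hA : ∀ v, a * ‖v‖ ^ 2 ≤ A v v) (v : V) : A.inverse (A v) = v := by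
  obtain ⟨e, rfl⟩ := exists_continuousLinearEquiv_of_coercive ha hA
  simp

theorem norm_inverse_apply_le_of_coercive {A : V →L[ℝ] V →L[ℝ] ℝ} {a : ℝ} (ha : 0 < a)
    (hA : ∀ v, a * ‖v‖ ^ 2 ≤ A v v) (g : V →L[ℝ] ℝ) : ‖A.inverse g‖ ≤ ‖g‖ / a := by
  simpa only [apply_inverse_of_coercive ha hA] using norm_le_of_coercive ha hA (A.inverse g)

theorem contDiffAt_inverse_of_coercive {A : V →L[ℝ] V →L[ℝ] ℝ} {a : ℝ} (ha : 0 < a)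
    (hA : ∀ v, a * ‖v‖ ^ 2 ≤ A v v) {n : WithTop ℕ∞} :
    ContDiffAt ℝ n (ContinuousLinearMap.inverse : (V →L[ℝ] V →L[ℝ] ℝ) → _) A := by
  obtain ⟨e, rfl⟩ := exists_continuousLinearEquiv_of_coercive ha hA
  exact contDiffAt_map_inverse e

end Coercive

section AffineFamily

variable {V : Type*} [NormedAddCommGroup V] [InnerProductSpace ℝ V] {ι : Type*}

/-- The iterated solution `R Ψ_{i₁} R Ψ_{i₂} ⋯ R f`, where `R` is the inverse of `A`. -/
noncomputable def iteratedSolution (Ψ : ι → V →L[ℝ] V →L[ℝ] ℝ) (f : V →L[ℝ] ℝ)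
    (A : V →L[ℝ] V →L[ℝ] ℝ) : List ι → V
  | [] => A.inverse f
  | i :: l => A.inverse (Ψ i (iteratedSolution Ψ f A l))

variable [CompleteSpace V]

theorem norm_iteratedSolution_le (Ψ : ι → V →L[ℝ] V →L[ℝ] ℝ) (f : V →L[ℝ] ℝ)
    {A : V →L[ℝ] V →L[ℝ] ℝ} {a : ℝ} (ha : 0 < a) (hA : ∀ v, a * ‖v‖ ^ 2 ≤ A v v) (l : List ι) :
    ‖iteratedSolution Ψ f A l‖ ≤ (l.map fun i => ‖Ψ i‖ / a).prod * (‖f‖ / a) := by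
  induction l with
  | nil => simpa [iteratedSolution] using norm_inverse_apply_le_of_coercive ha hA f
  | cons i l ih =>
    calc ‖A.inverse (Ψ i (iteratedSolution Ψ f A l))‖
        ≤ ‖Ψ i (iteratedSolution Ψ f A l)‖ / a := norm_inverse_apply_le_of_coercive ha hA _
      _ ≤ ‖Ψ i‖ * ((l.map fun i => ‖Ψ i‖ / a).prod * (‖f‖ / a)) / a := by
          gcongr
          exact (Ψ i).le_opNorm_of_le ih
      _ = _ := by
          rw [List.map_cons, List.prod_cons]
          ring

variable [Fintype ι] {Ψ : ι → V →L[ℝ] V →L[ℝ] ℝ} {a : ℝ}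
  {B : (ι → ℝ) → (V →L[ℝ] V →L[ℝ] ℝ)} {U : Set (ι → ℝ)} {y : ι → ℝ}

theorem contDiffAt_inverse_comp (ha : 0 < a) (hA : ∀ v, a * ‖v‖ ^ 2 ≤ B y v v)
    {n : WithTop ℕ∞} (hBn : ContDiff ℝ n B) :
    ContDiffAt ℝ n (fun z => (B z).inverse) y :=
  (contDiffAt_inverse_of_coercive ha hA).comp y hBn.contDiffAt

theorem differentiableAt_iteratedSolution (f : V →L[ℝ] ℝ) (ha : 0 < a)
    (hA : ∀ v, a * ‖v‖ ^ 2 ≤ B y v v) (hBd : ContDiff ℝ 1 B) (l : List ι) :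
    DifferentiableAt ℝ (fun z => iteratedSolution Ψ f (B z) l) y := by
  have hR := (contDiffAt_inverse_comp ha hA hBd).differentiableAt one_ne_zero
  induction l with
  | nil => exact hR.clm_apply (differentiableAt_const f)
  | cons i l ih => exact hR.clm_apply ((Ψ i).differentiableAt.comp y ih)

variable [DecidableEq ι]

/-- The derivative of the inverse is `-R Ψ_j R`. -/
theorem fderiv_inverse_single (ha : 0 < a) (hU : IsOpen U)
    (hA : ∀ z ∈ U, ∀ v, a * ‖v‖ ^ 2 ≤ B z v v) (hBd : ContDiff ℝ 1 B)
    (hBΨ : ∀ z j, fderiv ℝ B z (Pi.single j 1) = Ψ j) (hy : y ∈ U) (j : ι) (g : V →L[ℝ] ℝ) :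
    fderiv ℝ (fun z => (B z).inverse) y (Pi.single j 1) g =
      -(B y).inverse (Ψ j ((B y).inverse g)) := by
  have hR := ((contDiffAt_inverse_comp ha (hA y hy) hBd).differentiableAt one_ne_zero).hasFDerivAt
  have hB' := (hBd.differentiable one_ne_zero y).hasFDerivAt
  set v := (B y).inverse g with hv
  have h1 := hR.clm_apply (hB'.clm_apply (hasFDerivAt_const v y))
  have h2 : HasFDerivAt (fun z => (B z).inverse (B z v)) (0 : (ι → ℝ) →L[ℝ] V) y := by
    refine (hasFDerivAt_const v y).congr_of_eventuallyEq ?_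
    filter_upwards [hU.mem_nhds hy] with z hz
    exact inverse_apply_of_coercive ha (hA z hz) v
  have h3 := DFunLike.congr_fun (h1.unique h2) (Pi.single j 1)
  simp [hBΨ] at h3
  rw [hv, apply_inverse_of_coercive ha (hA y hy), ← hv] at h3
  exact eq_neg_of_add_eq_zero_right h3

/-- Differentiating an iterated solution inserts the new index at every possible position. -/
theorem fderiv_iteratedSolution (f : V →L[ℝ] ℝ) (ha : 0 < a) (hU : IsOpen U)
    (hA : ∀ z ∈ U, ∀ v, a * ‖v‖ ^ 2 ≤ B z v v) (hBd : ContDiff ℝ 1 B)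
    (hBΨ : ∀ z j, fderiv ℝ B z (Pi.single j 1) = Ψ j) (hy : y ∈ U) (j : ι) (l : List ι) :
    fderiv ℝ (fun z => iteratedSolution Ψ f (B z) l) y (Pi.single j 1) =
      -((l.permutations'Aux j).map (iteratedSolution Ψ f (B y))).sum := by
  have hR := (contDiffAt_inverse_comp ha (hA y hy) hBd).differentiableAt one_ne_zero
  induction l with
  | nil =>
    simp only [iteratedSolution]
    rw [fderiv_clm_apply hR (differentiableAt_const f)]
    simp [fderiv_inverse_single ha hU hA hBd hBΨ hy, iteratedSolution]
  | cons i l ih =>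
    have hl := differentiableAt_iteratedSolution (Ψ := Ψ) f ha (hA y hy) hBd l
    have hΨ := (Ψ i).hasFDerivAt.comp y hl.hasFDerivAt
    have h := (hR.hasFDerivAt.clm_apply hΨ).fderiv
    simp only [iteratedSolution]
    erw [h]
    simp only [add_apply, ContinuousLinearMap.comp_apply,
      ContinuousLinearMap.flip_apply, Function.comp_apply,
      fderiv_inverse_single ha hU hA hBd hBΨ hy, ih, List.permutations'Aux, List.map_cons,
      List.sum_cons, List.map_map, map_neg, map_list_sum, iteratedSolution, neg_add]
    rw [add_comm]
    rfl

/-- The iterated derivatives of the solution map, as sums over all orderings. -/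
theorem iteratedFDeriv_inverse_apply (f : V →L[ℝ] ℝ) (ha : 0 < a) (hU : IsOpen U)
    (hA : ∀ z ∈ U, ∀ v, a * ‖v‖ ^ 2 ≤ B z v v) (hBd : ContDiff ℝ (⊤ : ℕ∞) B)
    (hBΨ : ∀ z j, fderiv ℝ B z (Pi.single j 1) = Ψ j) (n : ℕ) (m : Fin n → ι) (hy : y ∈ U) :
    iteratedFDeriv ℝ n (fun z => (B z).inverse f) y (fun i => Pi.single (m i) 1) =
      (-1 : ℝ) ^ n • ((List.ofFn m).permutations'.map (iteratedSolution Ψ f (B y))).sum := by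
  have hB1 : ContDiff ℝ 1 B := hBd.of_le (by exact_mod_cast le_top)
  induction n generalizing y with
  | zero => simp [iteratedSolution]
  | succ n ih =>
    have hd : DifferentiableAt ℝ (iteratedFDeriv ℝ n fun z => (B z).inverse f) y :=
      ((contDiffAt_inverse_comp ha (hA y hy) hBd).clm_apply
        contDiffAt_const).differentiableAt_iteratedFDeriv (by exact_mod_cast WithTop.coe_lt_top n)
    have hsum (L : List (List ι)) :
        HasFDerivAt (fun z => (L.map (iteratedSolution Ψ f (B z))).sum)
          ((L.map fun l => fderiv ℝ (fun z => iteratedSolution Ψ f (B z) l) y).sum) y := by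
      induction L with
      | nil => simpa using hasFDerivAt_const (0 : V) y
      | cons l L ihL =>
        simpa using
          (differentiableAt_iteratedSolution (Ψ := Ψ) f ha (hA y hy) hB1 l).hasFDerivAt.fun_add ihL
    have hev : (fun z => iteratedFDeriv ℝ n (fun z => (B z).inverse f) z
          (fun i => Pi.single (m i.succ) 1)) =ᶠ[nhds y] fun z => (-1 : ℝ) ^ n •
        ((List.ofFn fun i : Fin n => m i.succ).permutations'.map
          (iteratedSolution Ψ f (B z))).sum := by
      filter_upwards [hU.mem_nhds hy] with z hz
      exact ih (fun i => m i.succ) hz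
    have happ := hd.hasFDerivAt.continuousMultilinear_apply_const
      (fun i : Fin n => (Pi.single (m i.succ) 1 : ι → ℝ))
    have heq := happ.unique (((hsum _).const_smul ((-1 : ℝ) ^ n)).congr_of_eventuallyEq hev)
    have heq' := DFunLike.congr_fun heq (Pi.single (m 0) 1)
    have hsplit (L : List (List ι)) :
        (L.map fun l => fderiv ℝ (fun z => iteratedSolution Ψ f (B z) l) y).sum
          (Pi.single (m 0) 1) =
        -((L.flatMap (List.permutations'Aux (m 0))).map (iteratedSolution Ψ f (B y))).sum := by
      induction L with
      | nil => simp
      | cons l L ihL =>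
        simp [ihL, fderiv_iteratedSolution f ha hU hA hB1 hBΨ hy, add_comm]
    rw [iteratedFDeriv_succ_apply_left, List.ofFn_succ, List.permutations', pow_succ]
    refine Eq.trans heq' ?_
    rw [smul_apply, hsplit]
    simp

theorem norm_iteratedFDeriv_inverse_apply_le (f : V →L[ℝ] ℝ) (ha : 0 < a) (hU : IsOpen U)
    (hA : ∀ z ∈ U, ∀ v, a * ‖v‖ ^ 2 ≤ B z v v) (hBd : ContDiff ℝ (⊤ : ℕ∞) B)
    (hBΨ : ∀ z j, fderiv ℝ B z (Pi.single j 1) = Ψ j) (n : ℕ) (m : Fin n → ι) (hy : y ∈ U) :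
    ‖iteratedFDeriv ℝ n (fun z => (B z).inverse f) y (fun i => Pi.single (m i) 1)‖ ≤
      n.factorial * (∏ i, ‖Ψ (m i)‖ / a) * (‖f‖ / a) := by
  rw [iteratedFDeriv_inverse_apply f ha hU hA hBd hBΨ n m hy, norm_smul]
  have hlen : (List.ofFn m).permutations'.length = n.factorial := by
    rw [← (List.permutations_perm_permutations' _).length_eq, List.length_permutations,
      List.length_ofFn]
  have hbound : ∀ x ∈ ((List.ofFn m).permutations'.map
      (iteratedSolution Ψ f (B y))).map norm, x ≤ (∏ i, ‖Ψ (m i)‖ / a) * (‖f‖ / a) := by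
    simp only [List.mem_map, List.mem_permutations']
    rintro _ ⟨_, ⟨l, hl, rfl⟩, rfl⟩
    refine (norm_iteratedSolution_le Ψ f ha (hA y hy) l).trans_eq ?_
    rw [(hl.map _).prod_eq, List.map_ofFn, List.prod_ofFn]
    rfl
  have hle := List.sum_le_card_nsmul _ _ hbound
  simp only [List.length_map, hlen, nsmul_eq_mul, ← mul_assoc] at hle
  simpa using (List.le_sum_of_subadditive norm norm_zero.le norm_add_le _).trans hle

end AffineFamily

/-- Parametric regularity (abstract `V`-norm estimate). Let `V` be a real Hilbert
space, `f ∈ V*`, and `B(y) = B₀ + ∑_{j} y_j Ψ_j` continuous bilinear forms on `V`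
which are uniformly coercive with constant `a_min > 0` on the closed cube
`[-1/2,1/2]^s`. Then there is a solution map `u` with `B(y)(u(y), v) = f(v)` for all
`v`, unique, satisfying `‖u(y)‖ ≤ ‖f‖/a_min`; `u` is infinitely differentiable on
the open cube; and every mixed partial derivative `∂^ν u(y)` (expressed via the
`|ν|`-th iterated Fréchet derivative applied to coordinate directions, the
coordinate `j` appearing `ν_j` times) is bounded by
`|ν|! (∏_j b_j^{ν_j}) ‖f‖/a_min` with `b_j = ‖Ψ_j‖/a_min`. -/
theorem stmt5 {V : Type*} [NormedAddCommGroup V] [InnerProductSpace ℝ V]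
    [CompleteSpace V] (s : ℕ) (f : V →L[ℝ] ℝ)
    (B0 : V →L[ℝ] V →L[ℝ] ℝ) (Ψ : Fin s → V →L[ℝ] V →L[ℝ] ℝ)
    (amin : ℝ) (hamin : 0 < amin)
    (B : (Fin s → ℝ) → (V →L[ℝ] V →L[ℝ] ℝ))
    (hB : ∀ y : Fin s → ℝ, B y = B0 + ∑ j, y j • Ψ j)
    (hcoer : ∀ y : Fin s → ℝ, (∀ j, |y j| ≤ 1 / 2) →
      ∀ v : V, amin * ‖v‖ ^ 2 ≤ B y v v)
    (b : Fin s → ℝ) (hb : ∀ j, b j = ‖Ψ j‖ / amin) :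
    ∃ u : (Fin s → ℝ) → V,
      (∀ y : Fin s → ℝ, (∀ j, |y j| ≤ 1 / 2) →
        (∀ v : V, B y (u y) v = f v) ∧
        (∀ w : V, (∀ v : V, B y w v = f v) → w = u y) ∧
        ‖u y‖ ≤ ‖f‖ / amin) ∧
      ContDiffOn ℝ (⊤ : ℕ∞) u {y : Fin s → ℝ | ∀ j, |y j| < 1 / 2} ∧
      (∀ (n : ℕ) (m : Fin n → Fin s) (y : Fin s → ℝ), (∀ j, |y j| < 1 / 2) →
        ‖iteratedFDeriv ℝ n u y (fun i => Pi.single (m i) (1 : ℝ))‖ ≤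
          (n.factorial : ℝ) *
            (∏ j, b j ^ (Finset.univ.filter (fun i => m i = j)).card) *
            (‖f‖ / amin)) := by
  have hBd : ContDiff ℝ (⊤ : ℕ∞) B := funext hB ▸ contDiff_const_add_sum_smul B0 Ψ
  have hBΨ (z : Fin s → ℝ) (j : Fin s) : fderiv ℝ B z (Pi.single j 1) = Ψ j :=
    funext hB ▸ fderiv_const_add_sum_smul_single B0 Ψ z j
  have hU : IsOpen {y : Fin s → ℝ | ∀ j, |y j| < 1 / 2} := by
    simp only [Set.ofPred_forall]
    exact isOpen_iInter_of_finite fun j => isOpen_lt (by fun_prop) continuous_const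
  have hA : ∀ y ∈ {y : Fin s → ℝ | ∀ j, |y j| < 1 / 2}, ∀ v, amin * ‖v‖ ^ 2 ≤ B y v v :=
    fun y hy => hcoer y fun j => (hy j).le
  refine ⟨fun y => (B y).inverse f, fun y hy => ⟨fun v => ?_, fun w hw => ?_, ?_⟩,
    fun y hy => ?_, fun n m y hy => ?_⟩
  · rw [apply_inverse_of_coercive hamin (hcoer y hy)]
  · rw [← ContinuousLinearMap.ext hw]
    exact (inverse_apply_of_coercive hamin (hcoer y hy) w).symm
  · exact norm_inverse_apply_le_of_coercive hamin (hcoer y hy) f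
  · exact ((contDiffAt_inverse_comp hamin (hA y hy) hBd).clm_apply
      contDiffAt_const).contDiffWithinAt
  · refine (norm_iteratedFDeriv_inverse_apply_le f hamin hU hA hBd hBΨ n m hy).trans_eq ?_
    simp only [← hb]
    rw [← Finset.prod_fiberwise Finset.univ m fun i => b (m i)]
    congr 2
    refine Finset.prod_congr rfl fun j _ => ?_
    rw [Finset.prod_congr rfl fun i hi => by rw [(Finset.mem_filter.1 hi).2], Finset.prod_const]
end

section
/- (Dimension truncation error, abstract form.) Let $V$ be a real Hilbert space, $f$ a continuous linear functional on $V$, $B_0$ and $(\Psi_j)_{j\ge 1}$ continuous bilinear forms on $V$ with $\sum_{j\ge 1} \|\Psi_j\| < \infty$, and let $a_{\min} > 0$ be such that for every $y = (y_j)_{j\ge 1} \in [-1/2,1/2]^{\mathbb{N}}$ the bilinear form $B(y) := B_0 + \sum_{j\ge 1} y_j \Psi_j$ satisfies $B(y)(v,v) \ge a_{\min}\|v\|_V^2$ for all $v \in V$. For $y \in [-1/2,1/2]^{\mathbb{N}}$ let $u(y) \in V$ be the unique solution of $B(y)(u(y),v) = f(v)$ for all $v \in V$, and for $s \in \mathbb{N}$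 let $u^s(y) := u(y_1,\dots,y_s,0,0,\dots)$ be the solution with all coordinates beyond $s$ set to zero. Then for every $y$ and every $s$, $\|u(y) - u^s(y)\|_V \le \dfrac{\|f\|_{V^*}}{2\,a_{\min}} \sum_{j \ge s+1} b_j$, where $b_j := \|\Psi_j\|/a_{\min}$. -/
/-- A priori bound for a coercive bilinear form: `a * ‖w‖ ≤ ‖g‖` whenever `A w w = g w`. -/
theorem mul_norm_le_of_coercive_of_apply_self_eq {V : Type*} [NormedAddCommGroup V]
    [NormedSpace ℝ V] {a : ℝ} {A : V →L[ℝ] V →L[ℝ] ℝ} {w : V} {g : V →L[ℝ] ℝ}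
    (hA : a * ‖w‖ ^ 2 ≤ A w w) (hw : A w w = g w) : a * ‖w‖ ≤ ‖g‖ := by
  rcases (norm_nonneg w).eq_or_lt with h | h
  · simp [← h]
  · have hg : g w ≤ ‖g‖ * ‖w‖ := (le_abs_self _).trans (g.le_opNorm w)
    refine le_of_mul_le_mul_right ?_ h
    linarith [show a * ‖w‖ * ‖w‖ = a * ‖w‖ ^ 2 by ring]

/-- A series with coefficients bounded by `c` changes by at most `c` times the tail of the norms
when its coefficients beyond the first `s` are set to zero. -/
theorem norm_tsum_truncate_sub_tsum_le {E : Type*} [NormedAddCommGroup E] [NormedSpace ℝ E]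
    [CompleteSpace E] {Ψ : ℕ → E} (hΨ : Summable fun j => ‖Ψ j‖) {c : ℝ} {y : ℕ → ℝ}
    (hy : ∀ j, |y j| ≤ c) (s : ℕ) :
    ‖∑' j, (if j < s then y j else 0) • Ψ j - ∑' j, y j • Ψ j‖ ≤ c * ∑' j, ‖Ψ (s + j)‖ := by
  have hle : ∀ j, ‖y j • Ψ j‖ ≤ c * ‖Ψ j‖ := fun j => by
    rw [norm_smul, Real.norm_eq_abs]
    exact mul_le_mul_of_nonneg_right (hy j) (norm_nonneg _)
  have hsum : Summable fun j => y j • Ψ j := .of_norm_bounded (hΨ.mul_left c) hle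
  have htrunc : ∑' j, (if j < s then y j else 0) • Ψ j = ∑ j ∈ Finset.range s, y j • Ψ j := by
    rw [tsum_eq_sum (s := Finset.range s) fun j hj => by simp_all]
    exact Finset.sum_congr rfl fun j hj => by simp_all
  have htail : Summable fun j => ‖Ψ (s + j)‖ := by
    simpa only [add_comm] using (summable_nat_add_iff s).2 hΨ
  rw [htrunc, ← hsum.sum_add_tsum_nat_add s, sub_add_cancel_left, norm_neg, ← tsum_mul_left]
  refine tsum_of_norm_bounded (htail.mul_left c).hasSum fun j => ?_
  rw [add_comm j s]
  exact hle (s + j)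

/-- Dimension truncation error (abstract form). Let `V` be a real Hilbert space,
`f ∈ V*`, `B(y) = B₀ + ∑'_{j} y_j Ψ_j` with `∑_j ‖Ψ_j‖ < ∞`, uniformly coercive
with constant `a_min > 0` for all `y` in the infinite cube `[-1/2,1/2]^ℕ`.
If `u(y)` solves `B(y)(u(y), v) = f(v)` for all `v`, and `u^s(y)` is the solution
with all coordinates of `y` beyond the first `s` set to zero, then
`‖u(y) - u^s(y)‖ ≤ (‖f‖/(2 a_min)) ∑_{j ≥ s} b_j` where `b_j = ‖Ψ_j‖/a_min`
(the indices `j : ℕ` here enumerate the sequence `(Ψ_j)_{j≥1}` of the paper, so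
the tail sum `∑' j, b (s + j)` is the tail beyond the first `s` terms). -/
theorem stmt6 {V : Type*} [NormedAddCommGroup V] [InnerProductSpace ℝ V]
    [CompleteSpace V] (f : V →L[ℝ] ℝ)
    (B0 : V →L[ℝ] V →L[ℝ] ℝ) (Ψ : ℕ → V →L[ℝ] V →L[ℝ] ℝ)
    (hΨ : Summable (fun j => ‖Ψ j‖))
    (amin : ℝ) (hamin : 0 < amin)
    (B : (ℕ → ℝ) → (V →L[ℝ] V →L[ℝ] ℝ))
    (hB : ∀ y : ℕ → ℝ, B y = B0 + ∑' j : ℕ, y j • Ψ j)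
    (hcoer : ∀ y : ℕ → ℝ, (∀ j, |y j| ≤ 1 / 2) →
      ∀ v : V, amin * ‖v‖ ^ 2 ≤ B y v v)
    (u : (ℕ → ℝ) → V)
    (hu : ∀ y : ℕ → ℝ, (∀ j, |y j| ≤ 1 / 2) → ∀ v : V, B y (u y) v = f v)
    (b : ℕ → ℝ) (hb : ∀ j, b j = ‖Ψ j‖ / amin)
    (y : ℕ → ℝ) (hy : ∀ j, |y j| ≤ 1 / 2) (s : ℕ) :
    ‖u y - u (fun j => if j < s then y j else 0)‖ ≤
      ‖f‖ / (2 * amin) * ∑' j : ℕ, b (s + j) := by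
  set z : ℕ → ℝ := fun j => if j < s then y j else 0 with hz_def
  have hz : ∀ j, |z j| ≤ 1 / 2 := fun j => by
    by_cases h : j < s
    · simpa [hz_def, h] using hy j
    · simp [hz_def, h]
  have hdiff : ‖B z - B y‖ ≤ 1 / 2 * ∑' j, ‖Ψ (s + j)‖ := by
    have hle := norm_tsum_truncate_sub_tsum_le (Ψ := Ψ) (c := 1 / 2) (y := y)
    rw [hB, hB, add_sub_add_left_eq_sub (∑' j, z j • Ψ j) (∑' j, y j • Ψ j) B0]
    exact hle hΨ hy s
  have huz : amin * ‖u z‖ ≤ ‖f‖ :=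
    mul_norm_le_of_coercive_of_apply_self_eq (hcoer z hz _) (hu z hz _)
  have hw : amin * ‖u y - u z‖ ≤ ‖(B z - B y) (u z)‖ := by
    refine mul_norm_le_of_coercive_of_apply_self_eq (hcoer y hy _) ?_
    rw [map_sub (B y), sub_apply, sub_apply, sub_apply, hu y hy, hu z hz]
  have hTsum : ∑' j, b (s + j) = (∑' j, ‖Ψ (s + j)‖) / amin := by
    simp only [hb, tsum_div_const]
  have hT : 0 ≤ ∑' j, ‖Ψ (s + j)‖ := tsum_nonneg fun j => (Ψ (s + j)).opNorm_nonneg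
  rw [hTsum]
  calc ‖u y - u z‖ ≤ ‖(B z - B y) (u z)‖ / amin := by rwa [le_div_iff₀' hamin]
    _ ≤ (1 / 2 * ∑' j, ‖Ψ (s + j)‖) * (‖f‖ / amin) / amin := by
      have huz' : ‖u z‖ ≤ ‖f‖ / amin := by rwa [le_div_iff₀' hamin]
      gcongr
      exact (B z - B y).le_of_opNorm_le_of_le hdiff huz'
    _ = ‖f‖ / (2 * amin) * ((∑' j, ‖Ψ (s + j)‖) / amin) := by field_simp
end

section
/- (Verification of the weight condition, Theorem 11.) Let $0 < p < q \le 1$ and let $\lambda \in (1/2, 1]$ satisfy $\lambda \ge q/(2-q)$. Let $(b_j)_{j\ge 1}$ be a non-increasing sequence of nonnegative reals with $\sum_{j\ge 1} b_j^p < \infty$, let $(\bar b_j)_{j\ge 1}$ be nonnegative reals with $b_j \le \bar b_j$ and $\sum_{j\ge 1} \bar b_j^q < \infty$, and set $\beta_j := \max(\bar b_j,\, b_j^{p/q})$. Define, for each finite subset $u \subset \mathbb{N}$, the weight $\gamma_u := \Big(\tfrac{(|u|+3)!}{6} \prod_{j\in u} \tfrac{\beta_j}{\sqrt{\rho(\lambda)}}\Big)^{2/(1+\lambda)}$.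 Then there exists a constant $C > 0$, depending on $p$, $q$, $\lambda$ and the sequences but independent of $s$ and $s'$, such that for all integers $1 \le s' < s$: $\displaystyle\sum_{\substack{u \subseteq \{1,\dots,s\} \\ u \cap \{s'+1,\dots,s\} \ne \emptyset}} \frac{(|u|!)^2 \prod_{j\in u} b_j^2}{\gamma_u} \;\le\; C\, (s')^{-2(1/p - 1/q)} \sum_{u \subseteq \{1,\dots,s\}} \frac{[(|u|+3)!]^2 \prod_{j\in u} b_j^2}{\gamma_u}$. -/
/-- `ρ(λ) = 2 ζ(2λ) / (2π²)^λ`, with `ζ(x) = ∑_{k ≥ 1} k^{-x}`. -/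
noncomputable def rhoQMC (lam : ℝ) : ℝ :=
  2 * (∑' k : ℕ, ((k : ℝ) + 1) ^ (-(2 * lam))) / (2 * Real.pi ^ 2) ^ lam

open Finset in
/-- A sum over the subsets of `A` that meet `t` is controlled by removing one element of `t`. -/
lemma sum_powerset_filter_inter_nonempty_le {ι : Type*} [DecidableEq ι] (A t : Finset ι)
    (T R : Finset ι → ℝ) (c : ι → ℝ) (hT : ∀ u ⊆ A, 0 ≤ T u) (hR : ∀ u ⊆ A, 0 ≤ R u)
    (hc : ∀ j ∈ t, 0 ≤ c j)
    (h : ∀ j ∈ t, ∀ v ⊆ A, j ∉ v → T (insert j v) ≤ c j * R v) :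
    ∑ u ∈ A.powerset.filter (fun u => (u ∩ t).Nonempty), T u ≤
      (∑ j ∈ t, c j) * ∑ u ∈ A.powerset, R u := by
  calc ∑ u ∈ A.powerset.filter (fun u => (u ∩ t).Nonempty), T u
      ≤ ∑ u ∈ A.powerset, ∑ j ∈ t, if j ∈ u then T u else 0 := by
        rw [sum_filter]
        refine sum_le_sum fun u hu => ?_
        have hTu := hT u (mem_powerset.1 hu)
        have hnn : ∀ j ∈ t, 0 ≤ if j ∈ u then T u else 0 := fun j _ => by split_ifs <;> simp [hTu]
        split_ifs with hne
        · obtain ⟨j, hj⟩ := hne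
          rw [mem_inter] at hj
          simpa [hj.1] using single_le_sum hnn hj.2
        · exact sum_nonneg hnn
    _ = ∑ j ∈ t, ∑ u ∈ A.powerset with j ∈ u, T u := by
        rw [sum_comm]
        simp only [sum_filter]
    _ ≤ ∑ j ∈ t, c j * ∑ u ∈ A.powerset, R u := by
        refine sum_le_sum fun j hj => ?_
        have hinj : Set.InjOn (fun u : Finset ι => u.erase j)
            (A.powerset.filter (fun u => j ∈ u) : Finset (Finset ι)) := by
          intro u hu v hv huv
          simp only [coe_filter, Set.mem_ofPred_eq] at hu hv
          rw [← insert_erase hu.2, ← insert_erase hv.2]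
          exact congrArg (insert j) huv
        calc ∑ u ∈ A.powerset with j ∈ u, T u
            ≤ ∑ u ∈ A.powerset with j ∈ u, c j * R (u.erase j) := by
              refine sum_le_sum fun u hu => ?_
              rw [mem_filter, mem_powerset] at hu
              simpa [insert_erase hu.2] using
                h j hj (u.erase j) ((erase_subset j u).trans hu.1) (notMem_erase j u)
          _ = c j * ∑ v ∈ (A.powerset.filter (fun u => j ∈ u)).image (fun u => u.erase j), R v := by
              rw [sum_image hinj, mul_sum]
          _ ≤ c j * ∑ u ∈ A.powerset, R u := by
              refine mul_le_mul_of_nonneg_left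
                (sum_le_sum_of_subset_of_nonneg ?_ fun u hu _ => hR u (mem_powerset.1 hu)) (hc j hj)
              intro v hv
              obtain ⟨u, hu, rfl⟩ := mem_image.1 hv
              rw [mem_filter, mem_powerset] at hu
              exact mem_powerset.2 ((erase_subset j u).trans hu.1)
    _ = (∑ j ∈ t, c j) * ∑ u ∈ A.powerset, R u := by rw [sum_mul]

/-- Tail bound for the powers of a non-increasing `ℓ^p` sequence (Stechkin's inequality). -/
lemma sum_Icc_rpow_le_of_antitone {p r : ℝ} (hp : 0 < p) (hpr : p ≤ r) {b : ℕ → ℝ}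
    (hb0 : ∀ j, 1 ≤ j → 0 ≤ b j) (hbmono : ∀ j k, 1 ≤ j → j ≤ k → b k ≤ b j)
    (hbp : Summable (fun j : ℕ => b (j + 1) ^ p)) {m : ℕ} (hm : 1 ≤ m) (n : ℕ) :
    ∑ j ∈ Finset.Icc (m + 1) n, b j ^ r ≤
      (∑' j : ℕ, b (j + 1) ^ p) ^ (r / p) * (m : ℝ) ^ (-(r / p - 1)) := by
  set S := ∑' j : ℕ, b (j + 1) ^ p
  have hpos : ∀ j, 1 ≤ j → 0 ≤ b j ^ p := fun j hj => Real.rpow_nonneg (hb0 j hj) p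
  have hS0 : 0 ≤ S := tsum_nonneg fun j => hpos _ (by omega)
  have hIcc : ∀ N, ∑ j ∈ Finset.Icc 1 N, b j ^ p ≤ S := by
    intro N
    have : ∑ j ∈ Finset.Icc 1 N, b j ^ p = ∑ j ∈ Finset.range N, b (j + 1) ^ p := by
      rw [Finset.range_eq_Ico, Finset.sum_Ico_add' (fun j => b j ^ p) 0 N 1]
      rfl
    rw [this]
    exact hbp.sum_le_tsum _ fun j _ => hpos _ (by omega)
  have hm0 : (0 : ℝ) < m := by exact_mod_cast hm
  have hbm : b m ^ p ≤ S / m := by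
    rw [le_div_iff₀ hm0]
    calc b m ^ p * m = ∑ _j ∈ Finset.Icc 1 m, b m ^ p := by simp [mul_comm]
      _ ≤ ∑ j ∈ Finset.Icc 1 m, b j ^ p := by
          refine Finset.sum_le_sum fun j hj => ?_
          rw [Finset.mem_Icc] at hj
          exact Real.rpow_le_rpow (hb0 m hm) (hbmono j m hj.1 hj.2) hp.le
      _ ≤ S := hIcc m
  have he : 0 ≤ r / p - 1 := by
    rw [sub_nonneg, le_div_iff₀ hp]
    linarith
  have hterm : ∀ j ∈ Finset.Icc (m + 1) n, b j ^ r ≤ b j ^ p * (S / m) ^ (r / p - 1) := by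
    intro j hj
    rw [Finset.mem_Icc] at hj
    have hj1 : 1 ≤ j := by omega
    have hsplit : b j ^ r = b j ^ p * (b j ^ p) ^ (r / p - 1) := by
      rw [← Real.rpow_mul (hb0 j hj1), ← Real.rpow_add_of_nonneg (hb0 j hj1) hp.le (by positivity)]
      congr 1
      field_simp
      ring
    rw [hsplit]
    refine mul_le_mul_of_nonneg_left (Real.rpow_le_rpow (hpos j hj1) ?_ he) (hpos j hj1)
    exact (Real.rpow_le_rpow (hb0 j hj1) (hbmono m j hm (by omega)) hp.le).trans hbm
  calc ∑ j ∈ Finset.Icc (m + 1) n, b j ^ r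
      ≤ (∑ j ∈ Finset.Icc (m + 1) n, b j ^ p) * (S / m) ^ (r / p - 1) := by
        rw [Finset.sum_mul]
        exact Finset.sum_le_sum hterm
    _ ≤ S * (S / m) ^ (r / p - 1) := by
        refine mul_le_mul_of_nonneg_right (le_trans ?_ (hIcc n)) (by positivity)
        refine Finset.sum_le_sum_of_subset_of_nonneg
          (Finset.Icc_subset_Icc_left (by omega)) fun j hj _ => hpos j (Finset.mem_Icc.1 hj).1
    _ = S ^ (r / p) * (m : ℝ) ^ (-(r / p - 1)) := by
        rw [Real.div_rpow hS0 hm0.le, Real.rpow_neg hm0.le, ← div_eq_mul_inv, ← mul_div_assoc]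
        congr 1
        nth_rewrite 1 [← Real.rpow_one S]
        rw [← Real.rpow_add_of_nonneg hS0 zero_le_one he]
        congr 1
        ring

/-- Cost of inserting one element in a POD-weighted term. -/
lemma pod_term_insert_le {a : ℝ} (ha : 0 ≤ a) {g b : ℕ → ℝ} {j : ℕ} {v : Finset ℕ}
    (hj : j ∉ v) (hgj : 0 ≤ g j) (hg : ∀ i ∈ v, 0 ≤ g i) :
    ((insert j v).card.factorial : ℝ) ^ 2 * (∏ i ∈ insert j v, b i ^ 2) /
        ((((insert j v).card + 3).factorial : ℝ) / 6 * ∏ i ∈ insert j v, g i) ^ a ≤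
      b j ^ 2 / g j ^ a * (((v.card + 3).factorial : ℝ) ^ 2 * (∏ i ∈ v, b i ^ 2) /
        (((v.card + 3).factorial : ℝ) / 6 * ∏ i ∈ v, g i) ^ a) := by
  rw [Finset.card_insert_of_notMem hj, Finset.prod_insert hj, Finset.prod_insert hj]
  set n := v.card
  have hG : 0 ≤ ∏ i ∈ v, g i := Finset.prod_nonneg hg
  have hB : 0 ≤ ∏ i ∈ v, b i ^ 2 := Finset.prod_nonneg fun i _ => sq_nonneg _
  set G := ∏ i ∈ v, g i
  set B := ∏ i ∈ v, b i ^ 2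
  have hF : (0 : ℝ) < ((n + 3).factorial : ℝ) / 6 := by positivity
  have hF1 : ((n + 3).factorial : ℝ) / 6 ≤ ((n + 1 + 3).factorial : ℝ) / 6 := by
    gcongr
    omega
  have hfac : ((n + 1).factorial : ℝ) ≤ ((n + 3).factorial : ℝ) := by
    gcongr
    omega
  rw [Real.mul_rpow (hF.le.trans hF1) (mul_nonneg hgj hG), Real.mul_rpow hgj hG,
    Real.mul_rpow hF.le hG]
  calc ((n + 1).factorial : ℝ) ^ 2 * (b j ^ 2 * B) /
        ((((n + 1 + 3).factorial : ℝ) / 6) ^ a * (g j ^ a * G ^ a))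
      = ((n + 1).factorial : ℝ) ^ 2 / (((n + 1 + 3).factorial : ℝ) / 6) ^ a *
          (b j ^ 2 / g j ^ a * (B / G ^ a)) := by
        rw [div_mul_div_comm, div_mul_div_comm]
    _ ≤ ((n + 3).factorial : ℝ) ^ 2 / (((n + 3).factorial : ℝ) / 6) ^ a *
          (b j ^ 2 / g j ^ a * (B / G ^ a)) := by
        gcongr
    _ = _ := by
        simp only [div_eq_mul_inv, mul_inv]
        ring

lemma sq_div_rpow_le {x y a t : ℝ} (hx : 0 ≤ x) (ha : 0 ≤ a) (hxy : x ^ t ≤ y) :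
    x ^ 2 / y ^ a ≤ x ^ (2 - a * t) := by
  rcases hx.eq_or_lt with rfl | hx
  · simpa using Real.rpow_nonneg le_rfl _
  · have ht : 0 < x ^ t := Real.rpow_pos_of_pos hx t
    calc x ^ 2 / y ^ a ≤ x ^ 2 / (x ^ t) ^ a := by gcongr
      _ = x ^ (2 - a * t) := by
        rw [← Real.rpow_mul hx.le, Real.rpow_sub hx, Real.rpow_two, mul_comm t a]

/-- Verification of the weight condition (Theorem 11): with `0 < p < q ≤ 1`,
`λ ∈ (1/2, 1]`, `λ ≥ q/(2-q)`, `(b_j)_{j≥1}` non-increasing nonnegative with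
`∑ b_j^p < ∞`, `b_j ≤ b̄_j`, `∑ b̄_j^q < ∞`, `β_j = max(b̄_j, b_j^{p/q})`, and the
POD weights `γ_u = ((|u|+3)!/6 ∏_{j∈u} β_j/√ρ(λ))^{2/(1+λ)}`, there is a constant
`C > 0` independent of `s` and `s'` such that for all `1 ≤ s' < s` the partial sum
over subsets `u ⊆ {1,…,s}` meeting `{s'+1,…,s}` of `(|u|!)² ∏ b_j² / γ_u` is at
most `C (s')^{-2(1/p - 1/q)}` times the full sum of `((|u|+3)!)² ∏ b_j² / γ_u`. -/
theorem stmt7 (p q lam : ℝ) (hp : 0 < p) (hpq : p < q) (hq : q ≤ 1)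
    (hlam1 : 1 / 2 < lam) (hlam2 : lam ≤ 1) (hlam3 : q / (2 - q) ≤ lam)
    (b bbar : ℕ → ℝ)
    (hb0 : ∀ j, 1 ≤ j → 0 ≤ b j)
    (hbmono : ∀ j k, 1 ≤ j → j ≤ k → b k ≤ b j)
    (hbp : Summable (fun j : ℕ => b (j + 1) ^ p))
    (hbbar0 : ∀ j, 1 ≤ j → 0 ≤ bbar j)
    (hble : ∀ j, 1 ≤ j → b j ≤ bbar j)
    (hbbarq : Summable (fun j : ℕ => bbar (j + 1) ^ q))
    (β : ℕ → ℝ) (hβ : ∀ j, β j = max (bbar j) (b j ^ (p / q)))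
    (γ : Finset ℕ → ℝ)
    (hγ : ∀ u : Finset ℕ,
      γ u = (((u.card + 3).factorial : ℝ) / 6 *
        ∏ j ∈ u, β j / Real.sqrt (rhoQMC lam)) ^ (2 / (1 + lam))) :
    ∃ C : ℝ, 0 < C ∧ ∀ s' s : ℕ, 1 ≤ s' → s' < s →
      (∑ u ∈ (Finset.Icc 1 s).powerset.filter
          (fun u => (u ∩ Finset.Icc (s' + 1) s).Nonempty),
        (u.card.factorial : ℝ) ^ 2 * (∏ j ∈ u, b j ^ 2) / γ u) ≤
      C * (s' : ℝ) ^ (-(2 * (1 / p - 1 / q))) *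
        ∑ u ∈ (Finset.Icc 1 s).powerset,
          ((u.card + 3).factorial : ℝ) ^ 2 * (∏ j ∈ u, b j ^ 2) / γ u := by
  set a := 2 / (1 + lam) with ha_def
  set σ := Real.sqrt (rhoQMC lam)
  have hσ : 0 ≤ σ := Real.sqrt_nonneg _
  have ha : 0 ≤ a := by positivity
  have hq0 : 0 < q := hp.trans hpq
  have haq : a ≤ 2 - q := by
    rw [div_le_iff₀ (by linarith)] at hlam3
    rw [ha_def, div_le_iff₀ (by linarith)]
    linarith
  have hβb : ∀ j, b j ^ (p / q) ≤ β j := fun j => by rw [hβ]; exact le_max_right _ _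
  have hβ0 : ∀ j, 1 ≤ j → 0 ≤ β j := fun j hj =>
    (Real.rpow_nonneg (hb0 j hj) _).trans (hβb j)
  have hg0 : ∀ j, 1 ≤ j → 0 ≤ β j / σ := fun j hj => div_nonneg (hβ0 j hj) hσ
  set r := 2 - a * (p / q) with hr_def
  set e := 2 * (1 / p - 1 / q) with he_def
  have he : e ≤ r / p - 1 := by
    have h1 : r / p - 1 - e = (2 - q - a) / q := by
      rw [hr_def, he_def]
      field_simp
      ring
    have h2 : 0 ≤ (2 - q - a) / q := div_nonneg (by linarith) hq0.le
    linarith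
  have he0 : 0 ≤ e := by
    have := one_div_le_one_div_of_le hp hpq.le
    rw [he_def]
    linarith
  have hpr : p ≤ r := by
    have : 1 ≤ r / p := by linarith
    rwa [one_le_div hp] at this
  set S := ∑' j : ℕ, b (j + 1) ^ p with hS_def
  have hS : 0 ≤ S := tsum_nonneg fun j => Real.rpow_nonneg (hb0 _ (by omega)) p
  refine ⟨σ ^ a * S ^ (r / p) + 1, by positivity, fun m s hm _ => ?_⟩
  have hγ0 : ∀ u ⊆ Finset.Icc 1 s, 0 ≤ γ u := fun u hu => by
    rw [hγ]
    have : 0 ≤ ∏ j ∈ u, β j / σ :=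
      Finset.prod_nonneg fun j hj => hg0 j (Finset.mem_Icc.1 (hu hj)).1
    positivity
  have hB : ∀ u : Finset ℕ, 0 ≤ ∏ j ∈ u, b j ^ 2 := fun u =>
    Finset.prod_nonneg fun j _ => sq_nonneg _
  have hR : ∀ u ⊆ Finset.Icc 1 s,
      0 ≤ ((u.card + 3).factorial : ℝ) ^ 2 * (∏ j ∈ u, b j ^ 2) / γ u := fun u hu =>
    div_nonneg (mul_nonneg (sq_nonneg _) (hB u)) (hγ0 u hu)
  have hc0 : ∀ j ∈ Finset.Icc (m + 1) s, 0 ≤ b j ^ 2 / (β j / σ) ^ a := fun j hj =>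
    div_nonneg (sq_nonneg _)
      (Real.rpow_nonneg (hg0 j (by rw [Finset.mem_Icc] at hj; omega)) _)
  refine (sum_powerset_filter_inter_nonempty_le (Finset.Icc 1 s) (Finset.Icc (m + 1) s) _
    (fun u => ((u.card + 3).factorial : ℝ) ^ 2 * (∏ j ∈ u, b j ^ 2) / γ u)
    (fun j => b j ^ 2 / (β j / σ) ^ a)
    (fun u hu => div_nonneg (mul_nonneg (sq_nonneg _) (hB u)) (hγ0 u hu)) hR hc0
    fun j hj v hv hjv => ?_).trans ?_
  · simp only [hγ]
    exact pod_term_insert_le ha hjv (hg0 j (by rw [Finset.mem_Icc] at hj; omega))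
      fun i hi => hg0 i (Finset.mem_Icc.1 (hv hi)).1
  refine mul_le_mul_of_nonneg_right ?_
    (Finset.sum_nonneg fun u hu => hR u (Finset.mem_powerset.1 hu))
  have hm1 : (1 : ℝ) ≤ m := by exact_mod_cast hm
  calc ∑ j ∈ Finset.Icc (m + 1) s, b j ^ 2 / (β j / σ) ^ a
      ≤ ∑ j ∈ Finset.Icc (m + 1) s, σ ^ a * b j ^ r := by
        refine Finset.sum_le_sum fun j hj => ?_
        have hj1 : 1 ≤ j := by rw [Finset.mem_Icc] at hj; omega
        rw [Real.div_rpow (hβ0 j hj1) hσ, div_div_eq_mul_div, mul_comm, mul_div_assoc]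
        exact mul_le_mul_of_nonneg_left (sq_div_rpow_le (hb0 j hj1) ha (hβb j))
          (Real.rpow_nonneg hσ _)
    _ ≤ σ ^ a * (S ^ (r / p) * (m : ℝ) ^ (-(r / p - 1))) := by
        rw [← Finset.mul_sum]
        exact mul_le_mul_of_nonneg_left
          (sum_Icc_rpow_le_of_antitone hp hpr hb0 hbmono hbp hm s) (Real.rpow_nonneg hσ _)
    _ ≤ σ ^ a * (S ^ (r / p) * (m : ℝ) ^ (-e)) := by
        gcongr
    _ ≤ (σ ^ a * S ^ (r / p) + 1) * (m : ℝ) ^ (-e) := by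
        rw [add_mul, ← mul_assoc]
        have : 0 ≤ (m : ℝ) ^ (-e) := by positivity
        linarith
end

section
/- (Finiteness of $A_\lambda$ in Theorem 10.) Let $q \in (0,1)$, let $\lambda \in (1/2, 1)$ satisfy $\lambda \ge q/(2-q)$ (equivalently $q \le 2\lambda/(1+\lambda)$), and let $(\bar b_j)_{j\ge 1}$ be nonnegative real numbers with $\sum_{j\ge 1} \bar b_j^q < \infty$. Then the sum over all finite subsets $u$ of $\mathbb{N}$, $A_\lambda := \sum_{|u|<\infty} \big[(|u|+3)!\big]^{2\lambda/(1+\lambda)} \prod_{j \in u} \big(\bar b_j^{2\lambda}\, \rho(\lambda)\big)^{1/(1+\lambda)}$, is finite (the family is summable). -/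
/-- The elementary symmetric sums of nonnegative numbers satisfy `e_n ≤ (∑ a)^n / n!`. -/
theorem sum_powersetCard_prod_le {ι : Type*} (a : ι → ℝ) (ha : ∀ i, 0 ≤ a i)
    (F : Finset ι) (n : ℕ) :
    ∑ u ∈ F.powersetCard n, ∏ i ∈ u, a i ≤ (∑ i ∈ F, a i) ^ n / (n.factorial : ℝ) := by
  classical
  induction F using Finset.induction_on generalizing n with
  | empty =>
    cases n with
    | zero => simp
    | succ n =>
      rw [Finset.powersetCard_eq_empty.2 (by simp)]
      simp
  | insert j F hj ih =>
    cases n with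
    | zero => simp
    | succ n =>
      have hS : 0 ≤ ∑ i ∈ F, a i := Finset.sum_nonneg fun i _ => ha i
      have hdisj : Disjoint (F.powersetCard (n + 1)) ((F.powersetCard n).image (insert j)) := by
        refine Finset.disjoint_left.2 fun u hu hu' => ?_
        obtain ⟨v, -, rfl⟩ := Finset.mem_image.1 hu'
        exact hj ((Finset.mem_powersetCard.1 hu).1 (Finset.mem_insert_self j v))
      have hnot : ∀ v ∈ F.powersetCard n, j ∉ v := fun v hv h =>
        hj ((Finset.mem_powersetCard.1 hv).1 h)
      have hinj : Set.InjOn (insert j) (F.powersetCard n : Set (Finset ι)) := by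
        intro v hv w hw h
        rw [← Finset.erase_insert (hnot v hv), ← Finset.erase_insert (hnot w hw)]
        exact congrArg (fun t => t.erase j) h
      rw [Finset.powersetCard_succ_insert hj, Finset.sum_union hdisj, Finset.sum_image hinj,
        Finset.sum_congr rfl fun v hv => Finset.prod_insert (hnot v hv), ← Finset.mul_sum,
        Finset.sum_insert hj]
      set S := ∑ i ∈ F, a i
      have hbern : S ^ (n + 1) + (n + 1) * (a j * S ^ n) ≤ (a j + S) ^ (n + 1) := by
        have h := pow_add_mul_le_add_pow hS (by linarith [ha j] : 0 ≤ 2 * S + a j) (n + 1)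
        rw [add_comm (a j) S]
        push_cast [Nat.add_sub_cancel] at h
        linarith
      calc _ ≤ S ^ (n + 1) / ((n + 1).factorial : ℝ) + a j * (S ^ n / (n.factorial : ℝ)) :=
            add_le_add (ih (n + 1)) (mul_le_mul_of_nonneg_left (ih n) (ha j))
        _ = (S ^ (n + 1) + (n + 1) * (a j * S ^ n)) / ((n + 1).factorial : ℝ) := by
            rw [Nat.factorial_succ]
            push_cast
            field_simp
        _ ≤ _ := by gcongr

/-- Summability of a cardinality-weighted family of products over finite subsets. -/
theorem summable_card_mul_prod {ι : Type*} {a : ι → ℝ} (ha : ∀ i, 0 ≤ a i) (hs : Summable a)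
    {c : ℕ → ℝ} (hc : ∀ n, 0 ≤ c n)
    (hcs : Summable fun n => c n * ((∑' i, a i) ^ n / (n.factorial : ℝ))) :
    Summable fun u : Finset ι => c u.card * ∏ i ∈ u, a i := by
  classical
  have hnn : ∀ u : Finset ι, 0 ≤ c u.card * ∏ i ∈ u, a i := fun u =>
    mul_nonneg (hc _) (Finset.prod_nonneg fun i _ => ha i)
  have hS : 0 ≤ ∑' i, a i := tsum_nonneg ha
  refine summable_of_sum_le (c := ∑' n, c n * ((∑' i, a i) ^ n / (n.factorial : ℝ))) hnn
    fun U => ?_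
  have hsub : U ⊆ (U.biUnion id).powerset := fun u hu =>
    Finset.mem_powerset.2 (Finset.subset_biUnion_of_mem id hu)
  refine (Finset.sum_le_sum_of_subset_of_nonneg hsub fun u _ _ => hnn u).trans ?_
  rw [Finset.sum_powerset]
  refine le_trans (Finset.sum_le_sum fun n _ => ?_)
    (hcs.sum_le_tsum _ fun n _ => mul_nonneg (hc n) (by positivity))
  rw [Finset.sum_congr rfl fun u hu => by rw [(Finset.mem_powersetCard.1 hu).2],
    ← Finset.mul_sum]
  refine mul_le_mul_of_nonneg_left ((sum_powersetCard_prod_le a ha _ n).trans ?_) (hc n)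
  have h0 : 0 ≤ ∑ i ∈ U.biUnion id, a i := Finset.sum_nonneg fun i _ => ha i
  have h1 := hs.sum_le_tsum (U.biUnion id) fun i _ => ha i
  gcongr

theorem summable_factorial_rpow_mul_pow_div_factorial {s : ℝ} (hs0 : 0 ≤ s) (hs1 : s < 1)
    {S : ℝ} (hS : 0 ≤ S) (k : ℕ) :
    Summable fun n : ℕ => ((n + k).factorial : ℝ) ^ s * (S ^ n / (n.factorial : ℝ)) := by
  have hlim : Filter.Tendsto
      (fun n : ℕ => (k + 1 : ℝ) ^ s * S * ((n : ℝ) + 1) ^ (-(1 - s))) Filter.atTop (nhds 0) := by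
    have h := ((tendsto_rpow_neg_atTop (sub_pos.2 hs1)).comp
      (Filter.tendsto_atTop_add_const_right _ (1 : ℝ)
        tendsto_natCast_atTop_atTop)).const_mul ((k + 1 : ℝ) ^ s * S)
    simpa using h
  refine summable_of_ratio_norm_eventually_le (r := 1 / 2) (by norm_num) ?_
  filter_upwards [hlim.eventually_le_const (show (0 : ℝ) < 1 / 2 by norm_num)] with n hn
  rw [Real.norm_of_nonneg (by positivity), Real.norm_of_nonneg (by positivity)]
  have hle : ((n : ℝ) + 1 + k) ^ s ≤ (k + 1 : ℝ) ^ s * ((n : ℝ) + 1) ^ s := by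
    rw [← Real.mul_rpow (by positivity) (by positivity)]
    refine Real.rpow_le_rpow (by positivity) ?_ hs0
    nlinarith [mul_nonneg (Nat.cast_nonneg (α := ℝ) k) (Nat.cast_nonneg (α := ℝ) n)]
  have hexp : ((n : ℝ) + 1) ^ (-(1 - s)) = ((n : ℝ) + 1) ^ s / ((n : ℝ) + 1) := by
    rw [show -(1 - s) = s - 1 by ring, Real.rpow_sub_one (by positivity)]
  have hratio : ((n : ℝ) + 1 + k) ^ s * S / ((n : ℝ) + 1) ≤ 1 / 2 := by
    refine le_trans ?_ hn
    rw [hexp, mul_div_assoc', mul_right_comm]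
    gcongr
  have hfac : ((n + 1 + k).factorial : ℝ) ^ s
      = ((n : ℝ) + 1 + k) ^ s * ((n + k).factorial : ℝ) ^ s := by
    rw [show n + 1 + k = n + k + 1 by ring, Nat.factorial_succ, Nat.cast_mul,
      Real.mul_rpow (by positivity) (by positivity)]
    push_cast
    ring_nf
  calc _ = ((n : ℝ) + 1 + k) ^ s * S / ((n : ℝ) + 1)
          * (((n + k).factorial : ℝ) ^ s * (S ^ n / (n.factorial : ℝ))) := by
        rw [hfac, Nat.factorial_succ]
        push_cast
        field_simp
        ring
    _ ≤ _ := by gcongr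

theorem Summable.rpow_of_le {ι : Type*} {b : ι → ℝ} (hb : ∀ i, 0 ≤ b i) {p q : ℝ}
    (hp : 0 < p) (hpq : p ≤ q) (h : Summable fun i => b i ^ p) :
    Summable fun i => b i ^ q := by
  refine h.of_norm_bounded_eventually ?_
  filter_upwards [h.tendsto_cofinite_zero.eventually_le_const zero_lt_one] with i hi
  rw [Real.norm_of_nonneg (Real.rpow_nonneg (hb i) q)]
  have hi1 : b i ≤ 1 := by
    by_contra! hlt
    exact absurd hi (not_le.2 (Real.one_lt_rpow hlt hp))
  exact Real.rpow_le_rpow_of_exponent_ge_of_imp (hb i) hi1 hpq fun _ h0 => by linarith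

theorem rhoQMC_nonneg (lam : ℝ) : 0 ≤ rhoQMC lam := by
  have h : 0 ≤ ∑' k : ℕ, ((k : ℝ) + 1) ^ (-(2 * lam)) := tsum_nonneg fun k => by positivity
  unfold rhoQMC
  positivity

/-- Finiteness of `A_λ` (Theorem 10): for `q ∈ (0,1)`, `λ ∈ (1/2,1)` with
`λ ≥ q/(2-q)`, and nonnegative `(b̄_j)` with `∑_j b̄_j^q < ∞`, the family
`u ↦ [(|u|+3)!]^{2λ/(1+λ)} ∏_{j∈u} (b̄_j^{2λ} ρ(λ))^{1/(1+λ)}`, indexed by the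
finite subsets `u` of `ℕ`, is summable. -/
theorem stmt9 (q lam : ℝ) (hq0 : 0 < q) (hq1 : q < 1)
    (hlam1 : 1 / 2 < lam) (hlam2 : lam < 1) (hlam3 : q / (2 - q) ≤ lam)
    (bbar : ℕ → ℝ) (hbbar : ∀ j, 0 ≤ bbar j)
    (hsum : Summable (fun j : ℕ => bbar j ^ q)) :
    Summable (fun u : Finset ℕ =>
      ((u.card + 3).factorial : ℝ) ^ (2 * lam / (1 + lam)) *
        ∏ j ∈ u, (bbar j ^ (2 * lam) * rhoQMC lam) ^ (1 / (1 + lam))) := by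
  have hl : 0 < 1 + lam := by linarith
  have hqs : q ≤ 2 * lam / (1 + lam) := by
    rw [div_le_iff₀ (by linarith)] at hlam3
    rw [le_div_iff₀ hl]
    linarith
  have hs1 : 2 * lam / (1 + lam) < 1 := by
    rw [div_lt_one hl]
    linarith
  have ha : ∀ j, 0 ≤ (bbar j ^ (2 * lam) * rhoQMC lam) ^ (1 / (1 + lam)) := fun j =>
    Real.rpow_nonneg (mul_nonneg (Real.rpow_nonneg (hbbar j) _) (rhoQMC_nonneg lam)) _
  have hasum : Summable fun j => (bbar j ^ (2 * lam) * rhoQMC lam) ^ (1 / (1 + lam)) := by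
    refine ((Summable.rpow_of_le hbbar hq0 hqs hsum).mul_right
      (rhoQMC lam ^ (1 / (1 + lam)))).congr fun j => ?_
    rw [Real.mul_rpow (Real.rpow_nonneg (hbbar j) _) (rhoQMC_nonneg lam),
      ← Real.rpow_mul (hbbar j), mul_one_div]
  exact summable_card_mul_prod ha hasum
    (c := fun n => ((n + 3).factorial : ℝ) ^ (2 * lam / (1 + lam))) (fun n => by positivity)
    (summable_factorial_rpow_mul_pow_div_factorial (hq0.le.trans hqs) hs1 (tsum_nonneg ha) 3)
end

section
/- (Optimality of POD weights, Theorem 10, minimization part.) Fix $\lambda \in (1/2, 1]$ and nonnegative reals $(\bar b_j)_{j\ge 1}$. For a family of positive weights $\gamma = (\gamma_u)$ indexed by finite subsets $u \subset \mathbb{N}$, define $D_\gamma(\lambda) := \Big(\sum_{|u|<\infty} \gamma_u^\lambda\, [\rho(\lambda)]^{|u|}\Big)^{1/\lambda} \cdot \Big(\sum_{|u|<\infty} \dfrac{[(|u|+3)!]^2 \prod_{j\in u} \bar b_j^2}{\gamma_u}\Big)$. Define the particular weights $\gamma^*_u := \Big(\tfrac{(|u|+3)!}{6} \prod_{j\in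 u} \tfrac{\bar b_j}{\sqrt{\rho(\lambda)}}\Big)^{2/(1+\lambda)}$ and set $A_\lambda := \sum_{|u|<\infty} [(|u|+3)!]^{2\lambda/(1+\lambda)} \prod_{j\in u} (\bar b_j^{2\lambda}\rho(\lambda))^{1/(1+\lambda)}$. If $A_\lambda < \infty$, then $D_{\gamma^*}(\lambda) = A_\lambda^{1/\lambda + 1}$, and $D_{\gamma^*}(\lambda) \le D_\gamma(\lambda)$ for every family of positive weights $\gamma$. -/
open scoped ENNReal

/-- Hölder's inequality for sums of extended nonnegative reals. -/
theorem ENNReal.tsum_mul_le_Lp_mul_Lq {ι : Type*} {p q : ℝ} (hpq : p.HolderConjugate q)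
    (f g : ι → ℝ≥0∞) :
    ∑' i, f i * g i ≤ (∑' i, f i ^ p) ^ (1 / p) * (∑' i, g i ^ q) ^ (1 / q) := by
  rw [ENNReal.tsum_eq_iSup_sum]
  refine iSup_le fun s => (ENNReal.inner_le_Lp_mul_Lq s f g hpq).trans ?_
  have := hpq.pos
  have := hpq.symm.pos
  gcongr <;> exact ENNReal.sum_le_tsum s

theorem rhoQMC_pos {lam : ℝ} (hlam : 1 / 2 < lam) : 0 < rhoQMC lam := by
  have hsum : Summable fun k : ℕ => ((k : ℝ) + 1) ^ (-(2 * lam)) := by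
    have h := (summable_nat_add_iff 1).2 (Real.summable_nat_rpow.2 (by linarith : -(2 * lam) < -1))
    simpa using h
  have hpos : 0 < ∑' k : ℕ, ((k : ℝ) + 1) ^ (-(2 * lam)) :=
    hsum.tsum_pos (fun k => by positivity) 0 (by positivity)
  unfold rhoQMC
  positivity

/-- The summand of the first factor of `D` at the optimal weight. -/
theorem optimal_weight_rpow_mul {l F B R c : ℝ} (hl : 0 < l) (hF : 0 < F) (hB : 0 ≤ B)
    (hR : 0 < R) (hc : 0 < c) :
    ((F / c * (B / √R)) ^ (2 / (1 + l))) ^ l * R =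
      (c ^ (-(2 / (1 + l)))) ^ l *
        (F ^ (2 * l / (1 + l)) * (B ^ (2 * l) * R) ^ (1 / (1 + l))) := by
  have hl' : 1 + l ≠ 0 := by positivity
  rcases hB.eq_or_lt with rfl | hB
  · have h₁ : 2 / (1 + l) ≠ 0 := by positivity
    have h₂ : (1 + l)⁻¹ ≠ 0 := by positivity
    simp [Real.zero_rpow, h₁, h₂, hl.ne']
  · obtain ⟨f, rfl⟩ : ∃ f, F = Real.exp f := ⟨_, (Real.exp_log hF).symm⟩
    obtain ⟨b, rfl⟩ : ∃ b, B = Real.exp b := ⟨_, (Real.exp_log hB).symm⟩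
    obtain ⟨r, rfl⟩ : ∃ r, R = Real.exp r := ⟨_, (Real.exp_log hR).symm⟩
    obtain ⟨d, rfl⟩ : ∃ d, c = Real.exp d := ⟨_, (Real.exp_log hc).symm⟩
    simp only [Real.sqrt_eq_rpow, ← Real.exp_mul, ← Real.exp_add, ← Real.exp_sub]
    congr 1
    field_simp
    ring

/-- The summand of the second factor of `D` at the optimal weight. -/
theorem div_optimal_weight {l F B R c : ℝ} (hl : 0 < l) (hF : 0 < F) (hB : 0 ≤ B)
    (hR : 0 < R) (hc : 0 < c) :
    F ^ 2 * B ^ 2 / (F / c * (B / √R)) ^ (2 / (1 + l)) =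
      (c ^ (-(2 / (1 + l))))⁻¹ *
        (F ^ (2 * l / (1 + l)) * (B ^ (2 * l) * R) ^ (1 / (1 + l))) := by
  have hl' : 1 + l ≠ 0 := by positivity
  rcases hB.eq_or_lt with rfl | hB
  · have h₂ : (1 + l)⁻¹ ≠ 0 := by positivity
    simp [Real.zero_rpow, h₂, hl.ne']
  · obtain ⟨f, rfl⟩ : ∃ f, F = Real.exp f := ⟨_, (Real.exp_log hF).symm⟩
    obtain ⟨b, rfl⟩ : ∃ b, B = Real.exp b := ⟨_, (Real.exp_log hB).symm⟩
    obtain ⟨r, rfl⟩ : ∃ r, R = Real.exp r := ⟨_, (Real.exp_log hR).symm⟩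
    obtain ⟨d, rfl⟩ : ∃ d, c = Real.exp d := ⟨_, (Real.exp_log hc).symm⟩
    simp only [Real.sqrt_eq_rpow, ← Real.exp_mul, ← Real.exp_add, ← Real.exp_sub,
      ← Real.exp_nat_mul, ← Real.exp_neg]
    congr 1
    push_cast
    field_simp
    ring

/-- The weight cancels in the geometric mean of the two summands of `D`. -/
theorem rpow_mul_rpow_div_weight {l F B R g : ℝ} (hl : 0 < l) (hF : 0 < F) (hB : 0 ≤ B)
    (hR : 0 < R) (hg : 0 < g) :
    (g ^ l * R) ^ (1 / (1 + l)) * (F ^ 2 * B ^ 2 / g) ^ (l / (1 + l)) =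
      F ^ (2 * l / (1 + l)) * (B ^ (2 * l) * R) ^ (1 / (1 + l)) := by
  have hl' : 1 + l ≠ 0 := by positivity
  rcases hB.eq_or_lt with rfl | hB
  · have h₁ : l / (1 + l) ≠ 0 := by positivity
    have h₂ : (1 + l)⁻¹ ≠ 0 := by positivity
    simp [Real.zero_rpow, h₁, h₂, hl.ne']
  · obtain ⟨f, rfl⟩ : ∃ f, F = Real.exp f := ⟨_, (Real.exp_log hF).symm⟩
    obtain ⟨b, rfl⟩ : ∃ b, B = Real.exp b := ⟨_, (Real.exp_log hB).symm⟩
    obtain ⟨r, rfl⟩ : ∃ r, R = Real.exp r := ⟨_, (Real.exp_log hR).symm⟩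
    obtain ⟨d, rfl⟩ : ∃ d, g = Real.exp d := ⟨_, (Real.exp_log hg).symm⟩
    simp only [← Real.exp_mul, ← Real.exp_add, ← Real.exp_sub, ← Real.exp_nat_mul]
    congr 1
    push_cast
    field_simp
    ring

theorem prod_div_sqrt_eq {ι : Type*} (u : Finset ι) (b : ι → ℝ) {r : ℝ} (hr : 0 ≤ r) :
    ∏ j ∈ u, b j / √r = (∏ j ∈ u, b j) / √(r ^ u.card) := by
  rw [Finset.prod_div_distrib, Finset.prod_const]
  congr 1
  rw [eq_comm, Real.sqrt_eq_iff_mul_self_eq (by positivity) (by positivity), ← mul_pow,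
    Real.mul_self_sqrt hr]

theorem prod_rpow_mul_rpow {ι : Type*} (u : Finset ι) {b : ι → ℝ} (hb : ∀ j, 0 ≤ b j) {r : ℝ}
    (hr : 0 ≤ r) (s t : ℝ) :
    ∏ j ∈ u, (b j ^ s * r) ^ t = ((∏ j ∈ u, b j) ^ s * r ^ u.card) ^ t := by
  rw [Real.finsetProd_rpow _ _ fun j _ => mul_nonneg (Real.rpow_nonneg (hb j) _) hr,
    Finset.prod_mul_distrib, Finset.prod_const, Real.finsetProd_rpow _ _ fun j _ => hb j]

/-- Optimality of POD weights (Theorem 10, minimization part). For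
`λ ∈ (1/2,1]` and nonnegative `(b̄_j)`, define for positive weights `γ`
`D_γ(λ) = (∑_{|u|<∞} γ_u^λ ρ(λ)^{|u|})^{1/λ} ⬝ ∑_{|u|<∞} [(|u|+3)!]² ∏_{j∈u} b̄_j² / γ_u`,
the sums taken in `ℝ≥0∞` (so `+∞` is allowed). With the particular weights
`γ*_u = ((|u|+3)!/6 ∏_{j∈u} b̄_j/√ρ(λ))^{2/(1+λ)}` and
`A_λ = ∑_{|u|<∞} [(|u|+3)!]^{2λ/(1+λ)} ∏_{j∈u} (b̄_j^{2λ} ρ(λ))^{1/(1+λ)} < ∞`,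
one has `D_{γ*}(λ) = A_λ^{1/λ+1}` and `D_{γ*}(λ) ≤ D_γ(λ)` for every family of
positive weights `γ`. -/
theorem stmt10 (lam : ℝ) (hlam1 : 1 / 2 < lam) (hlam2 : lam ≤ 1)
    (bbar : ℕ → ℝ) (hbbar : ∀ j, 0 ≤ bbar j)
    (D : (Finset ℕ → ℝ) → ℝ≥0∞)
    (hD : ∀ γ : Finset ℕ → ℝ,
      D γ = (∑' u : Finset ℕ, ENNReal.ofReal (γ u ^ lam * rhoQMC lam ^ u.card)) ^ (1 / lam) *
        ∑' u : Finset ℕ,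
          ENNReal.ofReal (((u.card + 3).factorial : ℝ) ^ 2 * (∏ j ∈ u, bbar j ^ 2) / γ u))
    (γstar : Finset ℕ → ℝ)
    (hγstar : ∀ u : Finset ℕ,
      γstar u = (((u.card + 3).factorial : ℝ) / 6 *
        ∏ j ∈ u, bbar j / Real.sqrt (rhoQMC lam)) ^ (2 / (1 + lam)))
    (Alam : ℝ)
    (hAsum : Summable (fun u : Finset ℕ =>
      ((u.card + 3).factorial : ℝ) ^ (2 * lam / (1 + lam)) *
        ∏ j ∈ u, (bbar j ^ (2 * lam) * rhoQMC lam) ^ (1 / (1 + lam))))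
    (hAlam : Alam = ∑' u : Finset ℕ,
      ((u.card + 3).factorial : ℝ) ^ (2 * lam / (1 + lam)) *
        ∏ j ∈ u, (bbar j ^ (2 * lam) * rhoQMC lam) ^ (1 / (1 + lam))) :
    D γstar = ENNReal.ofReal (Alam ^ (1 / lam + 1)) ∧
    ∀ γ : Finset ℕ → ℝ, (∀ u, 0 < γ u) → D γstar ≤ D γ := by
  have hl : 0 < lam := by linarith
  have hr := rhoQMC_pos hlam1
  set r := rhoQMC lam
  have hB (u : Finset ℕ) : 0 ≤ ∏ j ∈ u, bbar j := Finset.prod_nonneg fun j _ => hbbar j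
  have hF (u : Finset ℕ) : (0 : ℝ) < (u.card + 3).factorial := by positivity
  have hR (u : Finset ℕ) : 0 < r ^ u.card := by positivity
  simp only [prod_rpow_mul_rpow _ hbbar hr.le] at hAsum hAlam
  simp only [prod_div_sqrt_eq _ _ hr.le] at hγstar
  simp only [Finset.prod_pow] at hD
  set a : Finset ℕ → ℝ := fun u => ((u.card + 3).factorial : ℝ) ^ (2 * lam / (1 + lam)) *
    ((∏ j ∈ u, bbar j) ^ (2 * lam) * r ^ u.card) ^ (1 / (1 + lam)) with ha
  have ha0 (u : Finset ℕ) : 0 ≤ a u := by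
    have := hB u
    positivity
  have hA : ENNReal.ofReal Alam = ∑' u, ENNReal.ofReal (a u) := by
    rw [hAlam, ENNReal.ofReal_tsum_of_nonneg ha0 hAsum]
  have hA0 : 0 ≤ Alam := hAlam ▸ tsum_nonneg ha0
  set c : ℝ := (6 : ℝ) ^ (-(2 / (1 + lam)))
  have hc : 0 < c := by positivity
  have hstar : D γstar = ENNReal.ofReal (Alam ^ (1 / lam + 1)) := by
    have h₁ (u : Finset ℕ) : γstar u ^ lam * r ^ u.card = c ^ lam * a u := by
      rw [hγstar, optimal_weight_rpow_mul hl (hF u) (hB u) (hR u) (by norm_num)]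
    have h₂ (u : Finset ℕ) :
        ((u.card + 3).factorial : ℝ) ^ 2 * (∏ j ∈ u, bbar j) ^ 2 / γstar u = c⁻¹ * a u := by
      rw [hγstar, div_optimal_weight hl (hF u) (hB u) (hR u) (by norm_num)]
    have hcl : 0 ≤ c ^ lam := by positivity
    have hci : 0 ≤ c⁻¹ := by positivity
    simp only [hD, h₁, h₂, ENNReal.ofReal_mul hcl, ENNReal.ofReal_mul hci, ENNReal.tsum_mul_left,
      ← hA]
    rw [← ENNReal.ofReal_mul hcl, ← ENNReal.ofReal_mul hci,
      ENNReal.ofReal_rpow_of_nonneg (by positivity) (by positivity),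
      ← ENNReal.ofReal_mul (by positivity), Real.mul_rpow hcl hA0, ← Real.rpow_mul hc.le,
      mul_one_div_cancel hl.ne', Real.rpow_one, Real.rpow_add_one' hA0 (by positivity)]
    congr 1
    field_simp
  refine ⟨hstar, fun γ hγ => ?_⟩
  have hpq : (1 + lam).HolderConjugate ((1 + lam) / lam) := by
    rw [Real.holderConjugate_iff]
    constructor
    · linarith
    · field_simp
  have key := ENNReal.tsum_mul_le_Lp_mul_Lq hpq
    (fun u : Finset ℕ => ENNReal.ofReal (γ u ^ lam * r ^ u.card) ^ (1 / (1 + lam)))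
    (fun u : Finset ℕ => ENNReal.ofReal
      (((u.card + 3).factorial : ℝ) ^ 2 * (∏ j ∈ u, bbar j) ^ 2 / γ u) ^ (lam / (1 + lam)))
  have hprod (u : Finset ℕ) :
      ENNReal.ofReal (γ u ^ lam * r ^ u.card) ^ (1 / (1 + lam)) *
        ENNReal.ofReal (((u.card + 3).factorial : ℝ) ^ 2 * (∏ j ∈ u, bbar j) ^ 2 / γ u) ^
          (lam / (1 + lam)) = ENNReal.ofReal (a u) := by
    have := hγ u
    have := hB u
    rw [ENNReal.ofReal_rpow_of_nonneg (by positivity) (by positivity),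
      ENNReal.ofReal_rpow_of_nonneg (by positivity) (by positivity),
      ← ENNReal.ofReal_mul (by positivity),
      rpow_mul_rpow_div_weight hl (hF u) (hB u) (hR u) (hγ u)]
  have e₁ : 1 / (1 + lam) * (1 + lam) = 1 := by field_simp
  have e₂ : lam / (1 + lam) * ((1 + lam) / lam) = 1 := by field_simp
  simp only [hprod, ← ENNReal.rpow_mul, e₁, e₂, ENNReal.rpow_one, ← hA] at key
  have e₃ : 1 / (1 + lam) * (1 / lam + 1) = 1 / lam := by field_simp
  have e₄ : 1 / ((1 + lam) / lam) * (1 / lam + 1) = 1 := by field_simp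
  have hexp : 0 ≤ 1 / lam + 1 := by positivity
  rw [hstar, ← ENNReal.ofReal_rpow_of_nonneg hA0 hexp, hD]
  refine (ENNReal.rpow_le_rpow key hexp).trans_eq ?_
  rw [ENNReal.mul_rpow_of_nonneg _ _ hexp, ← ENNReal.rpow_mul, ← ENNReal.rpow_mul, e₃, e₄,
    ENNReal.rpow_one]
end

section
/- (Hölder estimate for $A_\lambda$.) Let $\lambda \in (1/2, 1)$, let $(\bar b_j)_{j\ge 1}$ be nonnegative reals, and let $(\alpha_j)_{j\ge 1}$ be positive reals with $\sum_{j\ge 1} \alpha_j < 1$ and $S := \sum_{j\ge 1} (\bar b_j/\alpha_j)^{2\lambda/(1-\lambda)} < \infty$. Then the sum over all finite subsets $u$ of $\mathbb{N}$, $A_\lambda := \sum_{|u|<\infty} [(|u|+3)!]^{2\lambda/(1+\lambda)} \prod_{j\in u} (\bar b_j^{2\lambda}\rho(\lambda))^{1/(1+\lambda)}$, is finite and satisfies $A_\lambda \le \Big[6\Big(\dfrac{1}{1 - \sum_{j\ge 1}\alpha_j}\Big)^{4}\Big]^{2\lambda/(1+\lambda)} \exp\Big(\dfrac{1-\lambda}{1+\lambda}\,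 [\rho(\lambda)]^{1/(1-\lambda)}\, S\Big)$. -/
theorem inv_pow_add_le_inv_sub_pow {x a : ℝ} (ha : 0 ≤ a) (hax : a < x) (n : ℕ) :
    (1 / x) ^ n + a * (n * (1 / x) ^ (n + 1)) ≤ (1 / (x - a)) ^ n := by
  have hx : 0 < x := ha.trans_lt hax
  have hxa : 0 < x - a := sub_pos.mpr hax
  have hax0 : 0 ≤ a / x := by positivity
  have bernoulli : 1 + (n : ℝ) * (a / x) ≤ (1 + a / x) ^ n :=
    one_add_mul_le_pow (by linarith) n
  have hbase : 1 / x * (1 + a / x) ≤ 1 / (x - a) := by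
    have : 1 / (x - a) - 1 / x * (1 + a / x) = a ^ 2 / (x ^ 2 * (x - a)) := by
      field_simp
      ring
    have : 0 ≤ a ^ 2 / (x ^ 2 * (x - a)) := by positivity
    linarith
  calc (1 / x) ^ n + a * (n * (1 / x) ^ (n + 1))
      = (1 / x) ^ n * (1 + n * (a / x)) := by ring
    _ ≤ (1 / x) ^ n * (1 + a / x) ^ n := by gcongr
    _ = (1 / x * (1 + a / x)) ^ n := (mul_pow _ _ _).symm
    _ ≤ (1 / (x - a)) ^ n := by gcongr

theorem sum_powerset_factorial_mul_prod_le {ι : Type*} {a : ι → ℝ} (ha : ∀ j, 0 ≤ a j)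
    (s : Finset ι) (hs : ∑ j ∈ s, a j < 1) (m : ℕ) :
    ∑ u ∈ s.powerset, ((u.card + m).factorial : ℝ) * ∏ j ∈ u, a j ≤
      m.factorial * (1 / (1 - ∑ j ∈ s, a j)) ^ (m + 1) := by
  classical
  induction s using Finset.induction_on generalizing m with
  | empty => simp
  | insert i s hi ih =>
    rw [Finset.sum_insert hi] at hs ⊢
    have hs' : ∑ j ∈ s, a j < 1 := by linarith [ha i]
    rw [Finset.sum_powerset_insert hi]
    have hshift : ∑ u ∈ s.powerset,
          (((insert i u).card + m).factorial : ℝ) * ∏ j ∈ insert i u, a j =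
        a i * ∑ u ∈ s.powerset, ((u.card + (m + 1)).factorial : ℝ) * ∏ j ∈ u, a j := by
      rw [Finset.mul_sum]
      refine Finset.sum_congr rfl fun u hu => ?_
      have hiu : i ∉ u := fun h => hi (Finset.mem_powerset.mp hu h)
      rw [Finset.card_insert_of_notMem hiu, Finset.prod_insert hiu,
        show u.card + 1 + m = u.card + (m + 1) by omega]
      ring
    rw [hshift]
    have hstep := inv_pow_add_le_inv_sub_pow (ha i)
      (show a i < 1 - ∑ j ∈ s, a j by linarith) (m + 1)
    calc _ ≤ (m.factorial : ℝ) * (1 / (1 - ∑ j ∈ s, a j)) ^ (m + 1) +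
          a i * ((m + 1).factorial * (1 / (1 - ∑ j ∈ s, a j)) ^ (m + 1 + 1)) :=
          add_le_add (ih hs' m) (mul_le_mul_of_nonneg_left (ih hs' (m + 1)) (ha i))
      _ = (m.factorial : ℝ) * ((1 / (1 - ∑ j ∈ s, a j)) ^ (m + 1) +
          a i * ((m + 1 : ℕ) * (1 / (1 - ∑ j ∈ s, a j)) ^ (m + 1 + 1))) := by
          rw [Nat.factorial_succ]
          push_cast
          ring
      _ ≤ (m.factorial : ℝ) * (1 / (1 - ∑ j ∈ s, a j - a i)) ^ (m + 1) := by gcongr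
      _ = _ := by rw [sub_sub, add_comm (a i)]

theorem sum_powerset_prod_le_exp {ι : Type*} {c : ι → ℝ} (hc : ∀ j, 0 ≤ c j) (s : Finset ι) :
    ∑ u ∈ s.powerset, ∏ j ∈ u, c j ≤ Real.exp (∑ j ∈ s, c j) := by
  classical
  rw [← Finset.prod_add_one, Real.exp_sum]
  exact Finset.prod_le_prod (fun j _ => by linarith [hc j]) fun j _ => Real.add_one_le_exp _

theorem sum_rpow_mul_rpow_le {ι : Type*} (s : Finset ι) {f g : ι → ℝ}
    (hf : ∀ i ∈ s, 0 ≤ f i) (hg : ∀ i ∈ s, 0 ≤ g i) {p q : ℝ} (hp : 0 < p) (hq : 0 < q)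
    (hpq : p + q = 1) :
    ∑ i ∈ s, f i ^ p * g i ^ q ≤ (∑ i ∈ s, f i) ^ p * (∑ i ∈ s, g i) ^ q := by
  have hconj : (1 / p).HolderConjugate (1 / q) := Real.holderConjugate_one_div hp hq hpq
  have key := Real.inner_le_Lp_mul_Lq_of_nonneg s hconj
    (fun i hi => Real.rpow_nonneg (hf i hi) p) (fun i hi => Real.rpow_nonneg (hg i hi) q)
  have h1 : ∑ i ∈ s, (f i ^ p) ^ (1 / p) = ∑ i ∈ s, f i :=
    Finset.sum_congr rfl fun i hi => by
      rw [← Real.rpow_mul (hf i hi), mul_one_div_cancel hp.ne', Real.rpow_one]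
  have h2 : ∑ i ∈ s, (g i ^ q) ^ (1 / q) = ∑ i ∈ s, g i :=
    Finset.sum_congr rfl fun i hi => by
      rw [← Real.rpow_mul (hg i hi), mul_one_div_cancel hq.ne', Real.rpow_one]
  simpa only [h1, h2, one_div_one_div] using key

theorem rpow_mul_rpow_eq_holder_split {lam a b r : ℝ} (h0 : 0 < lam) (h1 : lam < 1)
    (ha : 0 < a) (hb : 0 ≤ b) (hr : 0 ≤ r) :
    (b ^ (2 * lam) * r) ^ (1 / (1 + lam)) =
      a ^ (2 * lam / (1 + lam)) *
        (r ^ (1 / (1 - lam)) * (b / a) ^ (2 * lam / (1 - lam))) ^ ((1 - lam) / (1 + lam)) := by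
  have h1m : 1 - lam ≠ 0 := by linarith
  have h1p : 1 + lam ≠ 0 := by linarith
  have hba : 0 ≤ b / a := div_nonneg hb ha.le
  rw [Real.mul_rpow (by positivity) hr, Real.mul_rpow (by positivity) (by positivity),
    ← Real.rpow_mul hb, ← Real.rpow_mul hr, ← Real.rpow_mul hba,
    show 1 / (1 - lam) * ((1 - lam) / (1 + lam)) = 1 / (1 + lam) by field_simp,
    show 2 * lam / (1 - lam) * ((1 - lam) / (1 + lam)) = 2 * lam / (1 + lam) by field_simp,
    show 2 * lam * (1 / (1 + lam)) = 2 * lam / (1 + lam) by ring,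
    Real.div_rpow hb ha.le]
  have : a ^ (2 * lam / (1 + lam)) ≠ 0 := (Real.rpow_pos_of_pos ha _).ne'
  field_simp

/-- Hölder estimate for `A_λ`: for `λ ∈ (1/2,1)`, nonnegative `(b̄_j)`, and positive
`(α_j)` with `∑_j α_j < 1` and `S = ∑_j (b̄_j/α_j)^{2λ/(1-λ)} < ∞`, the sum over
all finite subsets `u ⊂ ℕ`,
`A_λ = ∑_{|u|<∞} [(|u|+3)!]^{2λ/(1+λ)} ∏_{j∈u} (b̄_j^{2λ} ρ(λ))^{1/(1+λ)}`,
is finite and bounded by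
`[6 (1/(1-∑_j α_j))⁴]^{2λ/(1+λ)} exp((1-λ)/(1+λ) ρ(λ)^{1/(1-λ)} S)`. -/
theorem stmt11 (lam : ℝ) (hlam1 : 1 / 2 < lam) (hlam2 : lam < 1)
    (bbar α : ℕ → ℝ) (hbbar : ∀ j, 0 ≤ bbar j) (hα : ∀ j, 0 < α j)
    (hαsum : Summable α) (hαlt : (∑' j : ℕ, α j) < 1)
    (S : ℝ)
    (hSsum : Summable (fun j : ℕ => (bbar j / α j) ^ (2 * lam / (1 - lam))))
    (hS : S = ∑' j : ℕ, (bbar j / α j) ^ (2 * lam / (1 - lam))) :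
    Summable (fun u : Finset ℕ =>
      ((u.card + 3).factorial : ℝ) ^ (2 * lam / (1 + lam)) *
        ∏ j ∈ u, (bbar j ^ (2 * lam) * rhoQMC lam) ^ (1 / (1 + lam))) ∧
    (∑' u : Finset ℕ,
      ((u.card + 3).factorial : ℝ) ^ (2 * lam / (1 + lam)) *
        ∏ j ∈ u, (bbar j ^ (2 * lam) * rhoQMC lam) ^ (1 / (1 + lam))) ≤
      (6 * (1 / (1 - ∑' j : ℕ, α j)) ^ 4) ^ (2 * lam / (1 + lam)) *
        Real.exp ((1 - lam) / (1 + lam) * rhoQMC lam ^ (1 / (1 - lam)) * S) := by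
  have hlam0 : 0 < lam := by linarith
  have hp : 0 < 2 * lam / (1 + lam) := by positivity
  have hq : 0 < (1 - lam) / (1 + lam) := div_pos (by linarith) (by linarith)
  have hpq : 2 * lam / (1 + lam) + (1 - lam) / (1 + lam) = 1 := by
    field_simp
    ring
  have hρ := rhoQMC_nonneg lam
  set c : ℕ → ℝ := fun j =>
    rhoQMC lam ^ (1 / (1 - lam)) * (bbar j / α j) ^ (2 * lam / (1 - lam)) with hc_def
  have hba : ∀ j, 0 ≤ bbar j / α j := fun j => div_nonneg (hbbar j) (hα j).le
  have hc : ∀ j, 0 ≤ c j := fun j =>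
    mul_nonneg (Real.rpow_nonneg hρ _) (Real.rpow_nonneg (hba j) _)
  have hcsum : Summable c := hSsum.mul_left _
  have hctsum : ∑' j, c j = rhoQMC lam ^ (1 / (1 - lam)) * S := by
    rw [hS, ← tsum_mul_left]
  set F : Finset ℕ → ℝ := fun u =>
    ((u.card + 3).factorial : ℝ) ^ (2 * lam / (1 + lam)) *
      ∏ j ∈ u, (bbar j ^ (2 * lam) * rhoQMC lam) ^ (1 / (1 + lam)) with hF_def
  have hF : ∀ u, 0 ≤ F u := fun u =>
    mul_nonneg (by positivity) (Finset.prod_nonneg fun j _ =>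
      Real.rpow_nonneg (mul_nonneg (Real.rpow_nonneg (hbbar j) _) hρ) _)
  have hsplit : ∀ u, F u =
      (((u.card + 3).factorial : ℝ) * ∏ j ∈ u, α j) ^ (2 * lam / (1 + lam)) *
        (∏ j ∈ u, c j) ^ ((1 - lam) / (1 + lam)) := fun u => by
    rw [Real.mul_rpow (by positivity) (Finset.prod_nonneg fun j _ => (hα j).le),
      ← Real.finsetProd_rpow u α fun j _ => (hα j).le,
      ← Real.finsetProd_rpow u c fun j _ => hc j, mul_assoc, ← Finset.prod_mul_distrib]
    exact congrArg _ (Finset.prod_congr rfl fun j _ =>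
      rpow_mul_rpow_eq_holder_split hlam0 hlam2 (hα j) (hbbar j) hρ)
  have hpowerset : ∀ s : Finset ℕ, ∑ u ∈ s.powerset, F u ≤
      (6 * (1 / (1 - ∑' j : ℕ, α j)) ^ 4) ^ (2 * lam / (1 + lam)) *
        Real.exp ((1 - lam) / (1 + lam) * rhoQMC lam ^ (1 / (1 - lam)) * S) := fun s => by
    have hαs : ∑ j ∈ s, α j ≤ ∑' j, α j := hαsum.sum_le_tsum s fun j _ => (hα j).le
    have hfac : ∑ u ∈ s.powerset, ((u.card + 3).factorial : ℝ) * ∏ j ∈ u, α j ≤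
        6 * (1 / (1 - ∑' j, α j)) ^ 4 := by
      refine (sum_powerset_factorial_mul_prod_le (fun j => (hα j).le) s
        (hαs.trans_lt hαlt) 3).trans ?_
      have : 0 < 1 - ∑' j, α j := by linarith
      have : 0 < 1 - ∑ j ∈ s, α j := by linarith
      norm_num [Nat.factorial]
      gcongr
    have hexp : ∑ u ∈ s.powerset, ∏ j ∈ u, c j ≤ Real.exp (∑' j, c j) :=
      (sum_powerset_prod_le_exp hc s).trans
        (Real.exp_le_exp.mpr (hcsum.sum_le_tsum s fun j _ => hc j))
    have hfac_nonneg : ∀ u ∈ s.powerset,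
        0 ≤ ((u.card + 3).factorial : ℝ) * ∏ j ∈ u, α j := fun u _ =>
      mul_nonneg (by positivity) (Finset.prod_nonneg fun j _ => (hα j).le)
    have hprod_nonneg : ∀ u ∈ s.powerset, 0 ≤ ∏ j ∈ u, c j := fun u _ =>
      Finset.prod_nonneg fun j _ => hc j
    rw [mul_assoc, ← hctsum, mul_comm ((1 - lam) / (1 + lam)), Real.exp_mul,
      Finset.sum_congr rfl fun u _ => hsplit u]
    refine (sum_rpow_mul_rpow_le _ hfac_nonneg hprod_nonneg hp hq hpq).trans ?_
    exact mul_le_mul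
      (Real.rpow_le_rpow (Finset.sum_nonneg hfac_nonneg) hfac hp.le)
      (Real.rpow_le_rpow (Finset.sum_nonneg hprod_nonneg) hexp hq.le)
      (Real.rpow_nonneg (Finset.sum_nonneg hprod_nonneg) _)
      (Real.rpow_nonneg ((Finset.sum_nonneg hfac_nonneg).trans hfac) _)
  have hfinite : ∀ T : Finset (Finset ℕ), ∑ u ∈ T, F u ≤
      (6 * (1 / (1 - ∑' j : ℕ, α j)) ^ 4) ^ (2 * lam / (1 + lam)) *
        Real.exp ((1 - lam) / (1 + lam) * rhoQMC lam ^ (1 / (1 - lam)) * S) := fun T =>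
    (Finset.sum_le_sum_of_subset_of_nonneg
      (fun u hu => Finset.mem_powerset.mpr (Finset.le_sup (f := id) hu))
      fun u _ _ => hF u).trans (hpowerset (T.sup id))
  exact ⟨summable_of_sum_le hF hfinite, Real.tsum_le_of_sum_le hF hfinite⟩
end

section
/- (Derivative bound for the difference of two truncated Galerkin solutions, key estimate in Theorem 8.) Let $V$ be a real Hilbert space, $V_h \subseteq V$ a closed subspace, $f$ a continuous linear functional on $V$, and $B_0, \Psi_1, \dots, \Psi_s$ continuous bilinear forms on $V$ such that, for some $a_{\min} > 0$, the form $B(y) := B_0 + \sum_{j=1}^{s} y_j \Psi_j$ satisfies $B(y)(v,v) \ge a_{\min}\|v\|_V^2$ for all $v \in V$ and all $y \in [-1/2,1/2]^s$. Set $b_j := \|\Psi_j\|/a_{\min}$. Fix an integer $1 \le s' \le s$. For $y \in (-1/2,1/2)^s$ let $u_h^{s}(y) \in V_h$ and $u_h^{s'}(y) \in V_h$ be the unique Galerkin solutions satisfying $B(y)(u_h^{s}(y), v_h) = f(v_h)$ for all $v_h \in V_h$, and $B(y_1,\dots,y_{s'},0,\dots,0)(u_h^{s'}(y), v_h) = f(v_h)$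 for all $v_h \in V_h$ (so $u_h^{s'}(y)$ depends only on $y_1,\dots,y_{s'}$). Then for every subset $u \subseteq \{1,\dots,s'\}$, the mixed first-order partial derivative $\partial_u := \prod_{j \in u} \partial/\partial y_j$ of the difference satisfies, for every $y \in (-1/2,1/2)^s$: $\big\|\partial_u\big(u_h^{s} - u_h^{s'}\big)(y)\big\|_V \;\le\; \Big(\tfrac{1}{2}\sum_{j=s'+1}^{s} b_j\Big)\, (|u|+1)!\, \Big(\prod_{j\in u} b_j\Big)\, \dfrac{\|f\|_{V^*}}{a_{\min}}$. -/
open scoped ContDiff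

section MixedPartials

variable {ι : Type*} [DecidableEq ι]
  {X Y : Type*} [NormedAddCommGroup X] [NormedSpace ℝ X] [NormedAddCommGroup Y] [NormedSpace ℝ Y]

/-- The iterated partial derivative of `g` in the coordinate directions listed in `l`. -/
noncomputable def mixedPartial (g : (ι → ℝ) → X) : List ι → (ι → ℝ) → X
  | [] => g
  | j :: l => fun y => fderiv ℝ (mixedPartial g l) y (Pi.single j 1)

theorem mixedPartial_cons (g : (ι → ℝ) → X) (j : ι) (l : List ι) (y : ι → ℝ) :
    mixedPartial g (j :: l) y = fderiv ℝ (mixedPartial g l) y (Pi.single j 1) :=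
  rfl

theorem mixedPartial_congr {U : Set (ι → ℝ)} (hU : IsOpen U) {g h : (ι → ℝ) → X}
    (hgh : Set.EqOn g h U) (l : List ι) : Set.EqOn (mixedPartial g l) (mixedPartial h l) U := by
  induction l with
  | nil => exact hgh
  | cons j l ih =>
    intro y hy
    have := (ih.eventuallyEq_of_mem (hU.mem_nhds hy)).fderiv_eq (𝕜 := ℝ)
    simp only [mixedPartial_cons, this]

theorem mixedPartial_const (c : X) (l : List ι) (hl : l ≠ []) :
    mixedPartial (fun _ : ι → ℝ => c) l = 0 := by
  induction l with
  | nil => exact absurd rfl hl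
  | cons j l ih =>
    rcases eq_or_ne l [] with rfl | h
    · ext y
      simp [mixedPartial]
    · ext y
      simp [mixedPartial, ih h]

variable [Fintype ι]

theorem ContDiffOn.mixedPartial {U : Set (ι → ℝ)} (hU : IsOpen U) {g : (ι → ℝ) → X}
    (hg : ContDiffOn ℝ ∞ g U) (l : List ι) : ContDiffOn ℝ ∞ (mixedPartial g l) U := by
  induction l with
  | nil => exact hg
  | cons j l ih => exact (ih.fderiv_of_isOpen hU (by simp)).clm_apply contDiffOn_const

theorem iteratedFDeriv_single_eq_mixedPartial {U : Set (ι → ℝ)} (hU : IsOpen U)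
    {g : (ι → ℝ) → X} (hg : ContDiffOn ℝ ∞ g U) (n : ℕ) (m : Fin n → ι) {y : ι → ℝ} (hy : y ∈ U) :
    iteratedFDeriv ℝ n g y (fun i => Pi.single (m i) (1 : ℝ)) =
      mixedPartial g (List.ofFn m) y := by
  induction n generalizing y with
  | zero => simp [mixedPartial]
  | succ n ih =>
    rw [iteratedFDeriv_succ_apply_left, List.ofFn_succ, mixedPartial_cons]
    have hd : DifferentiableAt ℝ (iteratedFDeriv ℝ n g) y :=
      (hg.contDiffAt (hU.mem_nhds hy)).differentiableAt_iteratedFDeriv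
        (by exact_mod_cast ENat.natCast_lt_top n)
    have he : (fun z => iteratedFDeriv ℝ n g z (fun i : Fin n => Pi.single (m i.succ) (1 : ℝ)))
        =ᶠ[nhds y] mixedPartial g (List.ofFn fun i => m i.succ) := by
      filter_upwards [hU.mem_nhds hy] with z hz
      exact ih _ hz
    rw [← he.fderiv_eq, fderiv_continuousMultilinear_apply_const_apply hd]
    rfl

/-- Leibniz rule for mixed partial derivatives of `A y (g y)` with `A` affine in `y`. -/
theorem mixedPartial_affine_apply {U : Set (ι → ℝ)} (hU : IsOpen U) {g : (ι → ℝ) → X}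
    (hg : ContDiffOn ℝ ∞ g U) (A₀ : X →L[ℝ] Y) (Φ : ι → X →L[ℝ] Y) (l : List ι) (hl : l.Nodup)
    {y : ι → ℝ} (hy : y ∈ U) :
    mixedPartial (fun y => (A₀ + ∑ j, y j • Φ j) (g y)) l y =
      (A₀ + ∑ j, y j • Φ j) (mixedPartial g l y) +
        ∑ j ∈ l.toFinset, Φ j (mixedPartial g (l.erase j) y) := by
  induction l generalizing y with
  | nil => simp [mixedPartial]
  | cons k l ih =>
    obtain ⟨hk, hl⟩ := List.nodup_cons.1 hl
    have he : mixedPartial (fun y => (A₀ + ∑ j, y j • Φ j) (g y)) l =ᶠ[nhds y] fun y =>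
        (A₀ + ∑ j, y j • Φ j) (mixedPartial g l y) +
          ∑ j ∈ l.toFinset, Φ j (mixedPartial g (l.erase j) y) := by
      filter_upwards [hU.mem_nhds hy] with z hz
      exact ih hl hz
    have hdiff (l' : List ι) :
        HasFDerivAt (mixedPartial g l') (fderiv ℝ (mixedPartial g l') y) y :=
      (((hg.mixedPartial hU l').contDiffAt (hU.mem_nhds hy)).differentiableAt
        (by simp)).hasFDerivAt
    have hA : HasFDerivAt (fun y : ι → ℝ => A₀ + ∑ j, y j • Φ j)
        (∑ j, (ContinuousLinearMap.proj (R := ℝ) (φ := fun _ : ι => ℝ) j).smulRight (Φ j)) y := by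
      refine (HasFDerivAt.fun_sum fun j _ => ?_).const_add A₀
      exact (ContinuousLinearMap.proj (R := ℝ) (φ := fun _ : ι => ℝ) j).hasFDerivAt.smul_const (Φ j)
    have hsum := HasFDerivAt.fun_sum (u := l.toFinset)
      fun j _ => (Φ j).hasFDerivAt.comp y (hdiff (l.erase j))
    have hsingle : ∑ j, (Pi.single k (1 : ℝ) : ι → ℝ) j • Φ j = Φ k := by
      simp [Pi.single_apply, ite_smul]
    have hder := ((hA.clm_apply (hdiff l)).add hsum).congr_of_eventuallyEq he
    rw [mixedPartial_cons, hder.fderiv, List.toFinset_cons, Finset.sum_insert (by simpa using hk),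
      List.erase_cons_head]
    have herase : ∀ j ∈ l.toFinset, Φ j (mixedPartial g ((k :: l).erase j) y) =
        Φ j (fderiv ℝ (mixedPartial g (l.erase j)) y (Pi.single k 1)) := by
      intro j hj
      have hjk : k ≠ j := by
        rintro rfl
        exact hk (by simpa using hj)
      rw [List.erase_cons_tail (by simpa using hjk)]
      rfl
    rw [Finset.sum_congr rfl herase]
    have hk' : (∑ j, (ContinuousLinearMap.proj (R := ℝ) (φ := fun _ : ι => ℝ) j).smulRight
        (Φ j)) (Pi.single k (1 : ℝ)) = Φ k := by
      rw [← hsingle]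
      simp
    simp only [add_apply, ContinuousLinearMap.flip_apply,
      ContinuousLinearMap.comp_apply, sum_apply, hk', mixedPartial_cons]
    abel

/-- If `A y (g y)` has mixed partial derivatives bounded by `c`, where `A` is affine and uniformly
bounded below, then those of `g` are bounded by any `C` with `c n + n * C (n - 1) ≤ C n`. -/
theorem norm_mixedPartial_le {U : Set (ι → ℝ)} (hU : IsOpen U) {g : (ι → ℝ) → X}
    (hg : ContDiffOn ℝ ∞ g U) (A₀ : X →L[ℝ] Y) (Φ : ι → X →L[ℝ] Y) {a : ℝ} (ha : 0 < a)
    (hA : ∀ y ∈ U, ∀ v, a * ‖v‖ ≤ ‖(A₀ + ∑ j, y j • Φ j) v‖) {b : ι → ℝ} (hb : ∀ j, 0 ≤ b j)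
    (hΦ : ∀ j, ‖Φ j‖ ≤ a * b j) (S : Set ι) (c C : ℕ → ℝ)
    (hC : ∀ n, c n + n * C (n - 1) ≤ C n) {y : ι → ℝ} (hy : y ∈ U)
    (hc : ∀ l : List ι, l.Nodup → (∀ j ∈ l, j ∈ S) →
      ‖mixedPartial (fun y => (A₀ + ∑ j, y j • Φ j) (g y)) l y‖ ≤
        a * (c l.length * (l.map b).prod))
    (l : List ι) (hl : l.Nodup) (hS : ∀ j ∈ l, j ∈ S) :
    ‖mixedPartial g l y‖ ≤ C l.length * (l.map b).prod := by
  induction hn : l.length generalizing l with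
  | zero =>
    have h1 := hA y hy (mixedPartial g l y)
    have h2 := mixedPartial_affine_apply hU hg A₀ Φ l hl hy
    have h3 := hc l hl hS
    obtain rfl := List.length_eq_zero_iff.1 hn
    have h4 := hC 0
    simp only [List.toFinset_nil, Finset.sum_empty, add_zero] at h2
    rw [← h2] at h1
    have h5 := le_of_mul_le_mul_left (h1.trans h3) ha
    simp at h4 h5 ⊢
    linarith
  | succ n ih =>
    have h1 := hA y hy (mixedPartial g l y)
    rw [← sub_eq_of_eq_add (mixedPartial_affine_apply hU hg A₀ Φ l hl hy)] at h1
    have hterm : ∀ j ∈ l.toFinset, ‖Φ j (mixedPartial g (l.erase j) y)‖ ≤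
        a * (C n * (l.map b).prod) := by
      intro j hj
      rw [List.mem_toFinset] at hj
      have h2 := ih (l.erase j) (hl.erase j) (fun i hi => hS i (List.mem_of_mem_erase hi))
        (by rw [List.length_erase_of_mem hj, hn]; rfl)
      calc ‖Φ j (mixedPartial g (l.erase j) y)‖
          ≤ ‖Φ j‖ * ‖mixedPartial g (l.erase j) y‖ := (Φ j).le_opNorm _
        _ ≤ (a * b j) * (C n * ((l.erase j).map b).prod) :=
          mul_le_mul (hΦ j) h2 (norm_nonneg _) (mul_nonneg ha.le (hb j))
        _ = a * (C n * (l.map b).prod) := by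
          rw [← List.prod_map_erase b hj]
          ring
    have hsum := (norm_sum_le l.toFinset fun j => Φ j (mixedPartial g (l.erase j) y)).trans
      (Finset.sum_le_card_nsmul _ _ _ hterm)
    rw [List.toFinset_card_of_nodup hl, hn, nsmul_eq_mul] at hsum
    have h3 := hc l hl hS
    rw [hn] at h3
    have hP : 0 ≤ (l.map b).prod := List.prod_nonneg (by simpa using fun j _ => hb j)
    have h4 := mul_le_mul_of_nonneg_right (hC (n + 1)) hP
    rw [Nat.add_sub_cancel] at h4
    refine le_of_mul_le_mul_left ?_ ha
    calc a * ‖mixedPartial g l y‖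
        ≤ a * (c (n + 1) * (l.map b).prod) + ((n + 1 : ℕ) : ℝ) * (a * (C n * (l.map b).prod)) :=
          h1.trans ((norm_sub_le _ _).trans (add_le_add h3 hsum))
      _ = a * ((c (n + 1) + ((n + 1 : ℕ) : ℝ) * C n) * (l.map b).prod) := by ring
      _ ≤ a * (C (n + 1) * (l.map b).prod) := mul_le_mul_of_nonneg_left h4 ha.le

/-- Dropping the coordinates outside `T` in an affine, uniformly bounded below family of operators
perturbs the mixed partial derivatives of the solutions in the remaining coordinates by a multiple
of the sum of the dropped coefficient bounds. -/
theorem norm_mixedPartial_sub_le {U : Set (ι → ℝ)} (hU : IsOpen U)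
    (hbox : ∀ y ∈ U, ∀ j, |y j| ≤ 1 / 2) {g g' : (ι → ℝ) → X} (hg : ContDiffOn ℝ ∞ g U)
    (hg' : ContDiffOn ℝ ∞ g' U) (A₀ : X →L[ℝ] Y) (Φ : ι → X →L[ℝ] Y) (T : Finset ι)
    {a : ℝ} (ha : 0 < a)
    (hA : ∀ y ∈ U, ∀ v, a * ‖v‖ ≤ ‖(A₀ + ∑ j, y j • Φ j) v‖)
    (hA' : ∀ y ∈ U, ∀ v, a * ‖v‖ ≤ ‖(A₀ + ∑ j, y j • if j ∈ T then Φ j else 0) v‖)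
    {b : ι → ℝ} (hb : ∀ j, 0 ≤ b j) (hΦ : ∀ j, ‖Φ j‖ ≤ a * b j) (F : Y)
    (hF : ∀ y ∈ U, (A₀ + ∑ j, y j • Φ j) (g y) = F)
    (hF' : ∀ y ∈ U, (A₀ + ∑ j, y j • if j ∈ T then Φ j else 0) (g' y) = F)
    {y : ι → ℝ} (hy : y ∈ U) (l : List ι) (hl : l.Nodup) (hT : ∀ j ∈ l, j ∈ T) :
    ‖mixedPartial (fun y => g y - g' y) l y‖ ≤
      (1 / 2 * ∑ j ∈ Tᶜ, b j) * (l.length + 1).factorial * (l.map b).prod * (‖F‖ / a) := by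
  have hgbound (l : List ι) (hl : l.Nodup) :
      ‖mixedPartial g l y‖ ≤ l.length.factorial * (‖F‖ / a) * (l.map b).prod := by
    refine norm_mixedPartial_le hU hg A₀ Φ ha hA hb hΦ Set.univ
      (fun n => if n = 0 then ‖F‖ / a else 0) (fun n => n.factorial * (‖F‖ / a)) ?_ hy ?_ l hl
      (by simp)
    · rintro (_ | n)
      · simp
      · simp [Nat.factorial_succ, mul_assoc]
    · intro l _ _
      rw [mixedPartial_congr hU (h := fun _ => F) (fun z hz => hF z hz) l hy]
      rcases eq_or_ne l [] with rfl | hne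
      · simp [mixedPartial, mul_div_cancel₀ _ ha.ne']
      · simp [mixedPartial_const F l hne, hne]
  have hres : Set.EqOn
      (fun y => (A₀ + ∑ j, y j • if j ∈ T then Φ j else 0) (g y - g' y))
      (fun y => (0 + ∑ j, y j • if j ∈ T then 0 else -Φ j) (g y)) U := by
    intro z hz
    have hsplit : (A₀ + ∑ j, z j • if j ∈ T then Φ j else 0) =
        (A₀ + ∑ j, z j • Φ j) + ∑ j, z j • if j ∈ T then 0 else -Φ j := by
      rw [add_assoc, ← Finset.sum_add_distrib]
      congr 1
      refine Finset.sum_congr rfl fun j _ => ?_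
      split_ifs <;> simp
    simp only [map_sub]
    rw [hF' z hz, hsplit, add_apply, hF z hz, zero_add, add_sub_cancel_left]
  set D := 1 / 2 * ∑ j ∈ Tᶜ, b j with hD
  have hD0 : 0 ≤ D := mul_nonneg (by norm_num) (Finset.sum_nonneg fun j _ => hb j)
  have hR : ‖(0 + ∑ j, y j • if j ∈ T then 0 else -Φ j)‖ ≤ a * D := by
    rw [zero_add]
    refine (norm_sum_le _ _).trans ?_
    rw [hD, Finset.mul_sum, Finset.mul_sum, ← Finset.sum_subset (Finset.subset_univ Tᶜ)]
    · refine Finset.sum_le_sum fun j hj => ?_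
      rw [if_neg (Finset.mem_compl.1 hj), norm_smul, norm_neg, Real.norm_eq_abs]
      calc |y j| * ‖Φ j‖ ≤ 1 / 2 * (a * b j) :=
            mul_le_mul (hbox y hy j) (hΦ j) (norm_nonneg _) (by norm_num)
        _ = a * (1 / 2 * b j) := by ring
    · intro j _ hj
      rw [if_pos (by simpa using hj), smul_zero, norm_zero]
  have key := norm_mixedPartial_le hU (hg.sub hg') A₀ (fun j => if j ∈ T then Φ j else 0) ha hA' hb
    (fun j => by
      split_ifs
      · exact hΦ j
      · simpa using mul_nonneg ha.le (hb j)) (T : Set ι)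
    (fun n => D * (n.factorial * (‖F‖ / a))) (fun n => D * ((n + 1).factorial * (‖F‖ / a))) ?_ hy ?_
    l hl hT
  · refine key.trans_eq ?_
    ring
  · rintro (_ | n)
    · simp
    · simp only [Nat.factorial_succ, Nat.add_sub_cancel]
      push_cast
      exact le_of_eq (by ring)
  · intro l hl hT
    rw [mixedPartial_congr hU hres l hy, mixedPartial_affine_apply hU hg _ _ l hl hy,
      Finset.sum_eq_zero (s := l.toFinset), add_zero]
    · refine ((0 + ∑ j, y j • if j ∈ T then 0 else -Φ j).le_opNorm _).trans ?_
      refine (mul_le_mul hR (hgbound l hl) (norm_nonneg _) (mul_nonneg ha.le hD0)).trans_eq ?_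
      ring
    · intro j hj
      have hjT : j ∈ T := hT j (List.mem_toFinset.1 hj)
      simp only [if_pos hjT, zero_apply]

end MixedPartials

section Affine

variable {X Y : Type*} [NormedAddCommGroup X] [NormedSpace ℝ X] [NormedAddCommGroup Y]
  [NormedSpace ℝ Y]

theorem contDiff_affine {ι : Type*} [Fintype ι] (A₀ : X) (Φ : ι → X) :
    ContDiff ℝ ∞ fun y : ι → ℝ => A₀ + ∑ j, y j • Φ j := by
  fun_prop

theorem norm_bilinearComp_le_of_isometry (L : Y →L[ℝ] X) (hL : ∀ v, ‖L v‖ = ‖v‖)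
    (C : X →L[ℝ] X →L[ℝ] ℝ) {c : ℝ} (hc : ‖C‖ ≤ c) : ‖C.bilinearComp L L‖ ≤ c := by
  refine (ContinuousLinearMap.opNorm_le_bound₂ _ (norm_nonneg C) fun v w => ?_).trans hc
  simpa [hL] using C.le_opNorm₂ (L v) (L w)

end Affine

section Coercive

variable {W : Type*} [NormedAddCommGroup W] [InnerProductSpace ℝ W]

theorem mul_norm_le_of_coercive {A : W →L[ℝ] W →L[ℝ] ℝ} {a : ℝ}
    (hA : ∀ v, a * ‖v‖ ^ 2 ≤ A v v) (v : W) : a * ‖v‖ ≤ ‖A v‖ := by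
  rcases eq_or_ne v 0 with rfl | hv
  · simp
  · refine le_of_mul_le_mul_right ?_ (norm_pos_iff.2 hv)
    calc a * ‖v‖ * ‖v‖ = a * ‖v‖ ^ 2 := by ring
      _ ≤ A v v := hA v
      _ ≤ ‖A v‖ * ‖v‖ := (le_abs_self _).trans ((A v).le_opNorm v)

/-- The Lax–Milgram theorem, as invertibility of the operator into the dual space. -/
theorem exists_equiv_of_coercive [CompleteSpace W] {A : W →L[ℝ] W →L[ℝ] ℝ} {a : ℝ} (ha : 0 < a)
    (hA : ∀ v, a * ‖v‖ ^ 2 ≤ A v v) :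
    ∃ e : W ≃L[ℝ] (W →L[ℝ] ℝ), (e : W →L[ℝ] W →L[ℝ] ℝ) = A := by
  have hco : IsCoercive A := ⟨a, ha, fun v => by simpa [pow_two, mul_assoc] using hA v⟩
  refine ⟨hco.continuousLinearEquivOfBilin.trans
    (InnerProductSpace.toDual ℝ W).toContinuousLinearEquiv, ?_⟩
  ext v w
  simp

/-- The solutions of a uniformly coercive affine family of variational problems depend smoothly on
the parameter. -/
theorem contDiffOn_of_coercive [CompleteSpace W] {ι : Type*} [Fintype ι] {U : Set (ι → ℝ)}
    (A₀ : W →L[ℝ] W →L[ℝ] ℝ) (Φ : ι → W →L[ℝ] W →L[ℝ] ℝ) {a : ℝ} (ha : 0 < a)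
    (hA : ∀ y ∈ U, ∀ v, a * ‖v‖ ^ 2 ≤ (A₀ + ∑ j, y j • Φ j) v v) (F : W →L[ℝ] ℝ)
    {g : (ι → ℝ) → W} (hg : ∀ y ∈ U, (A₀ + ∑ j, y j • Φ j) (g y) = F) :
    ContDiffOn ℝ ∞ g U := by
  have hinv : ContDiffOn ℝ ∞ (fun y => (A₀ + ∑ j, y j • Φ j).inverse F) U := by
    intro y hy
    obtain ⟨e, he⟩ := exists_equiv_of_coercive ha (hA y hy)
    have h1 : ContDiffAt ℝ ∞ (fun y : ι → ℝ => A₀ + ∑ j, y j • Φ j) y :=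
      (contDiff_affine A₀ Φ).contDiffAt
    have h2 := contDiffAt_map_inverse (n := ∞) e
    rw [he] at h2
    exact ((h2.comp y h1).clm_apply contDiffAt_const).contDiffWithinAt
  refine hinv.congr fun y hy => ?_
  obtain ⟨e, he⟩ := exists_equiv_of_coercive ha (hA y hy)
  rw [← hg y hy, ← he, ContinuousLinearMap.inverse_equiv]
  exact (e.symm_apply_apply (g y)).symm

/-- Mixed partial derivatives of the difference between the solutions of a uniformly coercive affine
family of variational problems and of the family truncated to the coordinates in `T`. -/
theorem norm_iteratedFDeriv_sub_le_of_coercive [CompleteSpace W] {ι : Type*} [Fintype ι]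
    [DecidableEq ι] {U : Set (ι → ℝ)} (hU : IsOpen U) (hbox : ∀ y ∈ U, ∀ j, |y j| ≤ 1 / 2)
    (A₀ : W →L[ℝ] W →L[ℝ] ℝ) (Φ : ι → W →L[ℝ] W →L[ℝ] ℝ) (T : Finset ι) {a : ℝ} (ha : 0 < a)
    (hA : ∀ y ∈ U, ∀ v, a * ‖v‖ ^ 2 ≤ (A₀ + ∑ j, y j • Φ j) v v)
    (hA' : ∀ y ∈ U, ∀ v, a * ‖v‖ ^ 2 ≤ (A₀ + ∑ j, y j • if j ∈ T then Φ j else 0) v v)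
    {b : ι → ℝ} (hb : ∀ j, 0 ≤ b j) (hΦ : ∀ j, ‖Φ j‖ ≤ a * b j) (F : W →L[ℝ] ℝ)
    {g g' : (ι → ℝ) → W} (hF : ∀ y ∈ U, (A₀ + ∑ j, y j • Φ j) (g y) = F)
    (hF' : ∀ y ∈ U, (A₀ + ∑ j, y j • if j ∈ T then Φ j else 0) (g' y) = F)
    {n : ℕ} (m : Fin n → ι) (hm : Function.Injective m) (hT : ∀ i, m i ∈ T)
    {y : ι → ℝ} (hy : y ∈ U) :
    ContDiffAt ℝ ∞ (fun y => g y - g' y) y ∧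
    ‖iteratedFDeriv ℝ n (fun y => g y - g' y) y (fun i => Pi.single (m i) (1 : ℝ))‖ ≤
      (1 / 2 * ∑ j ∈ Tᶜ, b j) * (n + 1).factorial * (∏ i, b (m i)) * (‖F‖ / a) := by
  have hg := contDiffOn_of_coercive A₀ Φ ha hA F hF
  have hg' := contDiffOn_of_coercive A₀ _ ha hA' F hF'
  refine ⟨(hg.sub hg').contDiffAt (hU.mem_nhds hy), ?_⟩
  have hmain := norm_mixedPartial_sub_le hU hbox hg hg' A₀ Φ T ha
    (fun y hy => mul_norm_le_of_coercive (hA y hy))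
    (fun y hy => mul_norm_le_of_coercive (hA' y hy)) hb hΦ F hF hF' hy (List.ofFn m)
    (List.nodup_ofFn.2 hm) (by simpa [List.mem_ofFn] using hT)
  rw [iteratedFDeriv_single_eq_mixedPartial hU (hg.sub hg') n m hy]
  simpa only [List.map_ofFn, List.prod_ofFn, List.length_ofFn, Function.comp_apply] using hmain

end Coercive

/-- Derivative bound for the difference of two truncated Galerkin solutions (key
estimate in Theorem 8). `V` is a real Hilbert space, `Vh ⊆ V` a closed subspace,
`B(y) = B₀ + ∑_{j} y_j Ψ_j` continuous bilinear forms, uniformly coercive with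
constant `a_min > 0` on the cube, `b_j = ‖Ψ_j‖/a_min`, and `1 ≤ s' ≤ s`. If
`u_h^s(y) ∈ Vh` and `u_h^{s'}(y) ∈ Vh` are the Galerkin solutions for `B(y)` and
for `B` at the truncation of `y` to its first `s'` coordinates respectively, then
for every subset `u` of the first `s'` coordinates, the mixed first-order partial
derivative `∂_u (u_h^s - u_h^{s'})(y)` (expressed as the `|u|`-th iterated Fréchet
derivative applied, once each, to the coordinate directions enumerating `u`)
satisfies
`‖∂_u (u_h^s - u_h^{s'})(y)‖ ≤ (½ ∑_{j ≥ s'} b_j) (|u|+1)! (∏_{j∈u} b_j) ‖f‖/a_min`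
for all `y` in the open cube. (Coordinates are indexed by `Fin s`, the coordinate
`j` with `(j : ℕ) < s'` being one of the first `s'`.) -/
theorem stmt14 {V : Type*} [NormedAddCommGroup V] [InnerProductSpace ℝ V]
    [CompleteSpace V] (s s' : ℕ) (hs' : 1 ≤ s') (hss : s' ≤ s)
    (Vh : Submodule ℝ V) (hVh : IsClosed (Vh : Set V))
    (f : V →L[ℝ] ℝ)
    (B0 : V →L[ℝ] V →L[ℝ] ℝ) (Ψ : Fin s → V →L[ℝ] V →L[ℝ] ℝ)
    (amin : ℝ) (hamin : 0 < amin)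
    (B : (Fin s → ℝ) → (V →L[ℝ] V →L[ℝ] ℝ))
    (hB : ∀ y : Fin s → ℝ, B y = B0 + ∑ j, y j • Ψ j)
    (hcoer : ∀ y : Fin s → ℝ, (∀ j, |y j| ≤ 1 / 2) →
      ∀ v : V, amin * ‖v‖ ^ 2 ≤ B y v v)
    (b : Fin s → ℝ) (hb : ∀ j, b j = ‖Ψ j‖ / amin)
    (uh uh' : (Fin s → ℝ) → V)
    (huh : ∀ y : Fin s → ℝ, (∀ j, |y j| < 1 / 2) →
      uh y ∈ Vh ∧ ∀ v ∈ Vh, B y (uh y) v = f v)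
    (huh' : ∀ y : Fin s → ℝ, (∀ j, |y j| < 1 / 2) →
      uh' y ∈ Vh ∧
        ∀ v ∈ Vh, B (fun j => if (j : ℕ) < s' then y j else 0) (uh' y) v = f v) :
    ∀ u : Finset (Fin s), (∀ j ∈ u, (j : ℕ) < s') →
    ∀ m : Fin u.card → Fin s, Function.Injective m → (∀ i, m i ∈ u) →
    ∀ y : Fin s → ℝ, (∀ j, |y j| < 1 / 2) →
      ‖iteratedFDeriv ℝ u.card (fun y => uh y - uh' y) y
          (fun i => Pi.single (m i) (1 : ℝ))‖ ≤
        (1 / 2 * ∑ j ∈ Finset.univ.filter (fun j : Fin s => s' ≤ (j : ℕ)), b j) *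
          ((u.card + 1).factorial : ℝ) * (∏ j ∈ u, b j) * (‖f‖ / amin) := by
  intro u hu m hm hmu y hy
  have : CompleteSpace Vh := hVh.completeSpace_coe
  set U : Set (Fin s → ℝ) := {y | ∀ j, |y j| < 1 / 2} with hUdef
  have hU : IsOpen U := by
    rw [hUdef, Set.ofPred_forall]
    exact isOpen_iInter_of_finite fun j => isOpen_lt (by fun_prop) continuous_const
  set T : Finset (Fin s) := Finset.univ.filter fun j : Fin s => (j : ℕ) < s' with hTdef
  set r : (V →L[ℝ] V →L[ℝ] ℝ) → (Vh →L[ℝ] Vh →L[ℝ] ℝ) := fun C =>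
    C.bilinearComp Vh.subtypeL Vh.subtypeL
  have hr_apply (C : V →L[ℝ] V →L[ℝ] ℝ) (v w : Vh) : r C v w = C v w := rfl
  have hb0 (j : Fin s) : 0 ≤ b j := by
    rw [hb]
    positivity
  have hrB (y : Fin s → ℝ) (v w : Vh) : (r B0 + ∑ j, y j • r (Ψ j)) v w = B y v w := by
    simp [hB, hr_apply, sum_apply]
  have hrB' (y : Fin s → ℝ) (v w : Vh) :
      (r B0 + ∑ j, y j • if j ∈ T then r (Ψ j) else 0) v w =
        B (fun j => if (j : ℕ) < s' then y j else 0) v w := by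
    rw [← hrB]
    congr 4 with j
    by_cases hj : (j : ℕ) < s' <;> simp [hTdef, hj]
  have hA (y) (hy : y ∈ U) (v : Vh) : amin * ‖v‖ ^ 2 ≤ (r B0 + ∑ j, y j • r (Ψ j)) v v := by
    rw [hrB]
    exact hcoer y (fun j => (hy j).le) v
  have hA' (y) (hy : y ∈ U) (v : Vh) :
      amin * ‖v‖ ^ 2 ≤ (r B0 + ∑ j, y j • if j ∈ T then r (Ψ j) else 0) v v := by
    rw [hrB']
    refine hcoer _ (fun j => ?_) v
    split_ifs
    · exact (hy j).le
    · norm_num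
  set F : Vh →L[ℝ] ℝ := f.comp Vh.subtypeL
  have hFf : ‖F‖ ≤ ‖f‖ := F.opNorm_le_bound (norm_nonneg _) fun v => f.le_opNorm v
  choose! g hg using
    fun z (hz : z ∈ U) => (⟨⟨uh z, (huh z hz).1⟩, rfl⟩ : ∃ x : Vh, (x : V) = uh z)
  choose! g' hg' using
    fun z (hz : z ∈ U) => (⟨⟨uh' z, (huh' z hz).1⟩, rfl⟩ : ∃ x : Vh, (x : V) = uh' z)
  have hgF (z) (hz : z ∈ U) : (r B0 + ∑ j, z j • r (Ψ j)) (g z) = F := by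
    refine ContinuousLinearMap.ext fun v => ?_
    rw [hrB, hg z hz, (huh z hz).2 v v.2]
    rfl
  have hgF' (z) (hz : z ∈ U) :
      (r B0 + ∑ j, z j • if j ∈ T then r (Ψ j) else 0) (g' z) = F := by
    refine ContinuousLinearMap.ext fun v => ?_
    rw [hrB', hg' z hz, (huh' z hz).2 v v.2]
    rfl
  have hΦ (j : Fin s) : ‖Ψ j‖ ≤ amin * b j := by
    rw [hb, mul_div_cancel₀ _ hamin.ne']
  obtain ⟨hsmooth, hmain⟩ := norm_iteratedFDeriv_sub_le_of_coercive hU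
    (fun y hy j => (hy j).le) (r B0) (fun j => r (Ψ j)) T hamin hA hA' hb0
    (fun j => norm_bilinearComp_le_of_isometry Vh.subtypeL (fun _ => rfl) (Ψ j) (hΦ j)) F hgF hgF'
    m hm (fun i => by simpa [hTdef] using hu _ (hmu i)) hy
  have hder : iteratedFDeriv ℝ u.card (fun y => uh y - uh' y) y
      (fun i => Pi.single (m i) (1 : ℝ)) =
      (iteratedFDeriv ℝ u.card (fun y => g y - g' y) y (fun i => Pi.single (m i) (1 : ℝ)) : Vh) := by
    have he : (fun y => uh y - uh' y) =ᶠ[nhds y] Vh.subtypeL ∘ fun y => g y - g' y := by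
      filter_upwards [hU.mem_nhds hy] with z hz
      simp [hg z hz, hg' z hz]
    rw [(he.iteratedFDeriv ℝ u.card).eq_of_nhds,
      Vh.subtypeL.iteratedFDeriv_comp_left hsmooth (by exact_mod_cast le_top)]
    rfl
  have hprod : ∏ i, b (m i) = ∏ j ∈ u, b j := by
    have himage : Finset.univ.image m = u := by
      refine Finset.eq_of_subset_of_card_le (by simpa [Finset.image_subset_iff] using hmu) ?_
      rw [Finset.card_image_of_injective _ hm, Finset.card_fin]
    conv_rhs => rw [← himage, Finset.prod_image hm.injOn]
  have hTc : Tᶜ = Finset.univ.filter fun j : Fin s => s' ≤ (j : ℕ) := by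
    ext j
    simp [hTdef]
  rw [hprod, hTc] at hmain
  rw [hder]
  refine (Vh.norm_coe _).trans_le <| hmain.trans (mul_le_mul_of_nonneg_left (by gcongr) ?_)
  have h1 : 0 ≤ ∏ j ∈ u, b j := Finset.prod_nonneg fun j _ => hb0 j
  have h2 : 0 ≤ ∑ j ∈ Finset.univ.filter (fun j : Fin s => s' ≤ (j : ℕ)), b j :=
    Finset.sum_nonneg fun j _ => hb0 j
  positivity
end
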